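/- arXiv:2307.11367 — 3 statements merged into one kernel-verified Lean document; each statement's English description precedes it below -/
import Mathlib

section
/- Let R be a commutative reduced ring with finitely many minimal primes that does not contain a field as a ring direct summand. Then the diagonal map μ : R → ∏_{r ∈ Reg(R)} R/rR, sending x to the family (x + rR), is a pure injective ring-module embedding, i.e., μ is injective and μ ⊗ id_M is injective for every finitely presented R-module M. -/
universe u

/-- A commutative ring `R` contains a field as a ring direct summand if
`R ≅ K × S` for some field `K` and some ring `S`. -/
def ContainsFieldSummand (R : Type u) [CommRing R] : Prop :=
  ∃ (K S : Type u), ∃ (_ : CommRing K) (_ : CommRing S),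
    IsField K ∧ Nonempty (R ≃+* K × S)

/-- The diagonal map `R → ∏_{r ∈ Reg(R)} R/rR`, `x ↦ (x + rR)_r`. -/
def diagMap (R : Type u) [CommRing R] :
    R →ₗ[R] ∀ _r : nonZeroDivisors R, R ⧸ Ideal.span {((_r : nonZeroDivisors R) : R)} :=
  LinearMap.pi fun r : nonZeroDivisors R => (Ideal.span {(r : R)}).mkQ

open nonZeroDivisors

theorem aux_comap_minimal (R : Type u) [CommRing R] [IsReduced R]
    (hfin : (minimalPrimes R).Finite) (P : Ideal (FractionRing R)) [hP : P.IsPrime] :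
    P.comap (algebraMap R (FractionRing R)) ∈ minimalPrimes R := by
  set p := P.comap (algebraMap R (FractionRing R)) with hp
  have hpp : p.IsPrime := Ideal.comap_isPrime _ _
  have hsub : (p : Set R) ⊆ ⋃ q ∈ minimalPrimes R, (q : Set R) := by
    intro x hx
    have hx' : x ∉ R⁰ := fun h => hP.ne_top
      (Ideal.eq_top_of_isUnit_mem _ hx (IsLocalization.map_units (FractionRing R) (⟨x, h⟩ : R⁰)))
    have h1 := Ideal.iUnion_minimalPrimes (I := (⊥ : Ideal R))
    have h2 : x ∈ ⋃ q ∈ (⊥ : Ideal R).minimalPrimes, (q : Set R) := by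
      rw [h1]
      have hr : (⊥ : Ideal R).radical = ⊥ := nilradical_eq_zero R
      rw [hr]
      rw [mem_nonZeroDivisors_iff_right] at hx'
      push Not at hx'
      obtain ⟨y, hy, hy0⟩ := hx'
      exact ⟨y, by simpa using hy0, by simpa [mul_comm] using hy⟩
    exact h2
  obtain ⟨q, hq, hle⟩ := (Ideal.subset_union_prime_finite hfin (f := fun I : Ideal R => I) ⊥ ⊥
    (fun i hi _ _ => hi.1.1)).1 hsub
  have : p = q := le_antisymm hle (hq.2 ⟨hpp, bot_le⟩ hle)
  rw [this]; exact hq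

theorem aux_semisimple (R : Type u) [CommRing R] [IsReduced R]
    (hfin : (minimalPrimes R).Finite) : IsSemisimpleRing (FractionRing R) := by
  have hinj : ∀ P P' : Ideal (FractionRing R), P.comap (algebraMap R (FractionRing R)) =
      P'.comap (algebraMap R (FractionRing R)) → P = P' := by
    intro P P' h
    have h' : P.under R = P'.under R := h
    rw [← IsLocalization.map_under R⁰ (FractionRing R) P, h', IsLocalization.map_under R⁰]
  have hf : Finite (MaximalSpectrum (FractionRing R)) := by
    have := hfin.to_subtype
    refine Finite.of_injective (β := minimalPrimes R)
      (fun m => ⟨m.asIdeal.comap (algebraMap R _), ?_⟩) ?_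
    · have := m.isMaximal.isPrime
      exact aux_comap_minimal R hfin _
    · intro m m' h
      ext1
      exact hinj _ _ (congrArg Subtype.val h)
  have hmax : ∀ P : Ideal (FractionRing R), P.IsPrime → P.IsMaximal := by
    intro P hP
    obtain ⟨M, hM, hle⟩ := P.exists_le_maximal hP.ne_top
    have := hM.isPrime
    have h1 := aux_comap_minimal R hfin M
    have h2 := aux_comap_minimal R hfin P
    have : P = M := hinj _ _ (le_antisymm (Ideal.comap_mono hle)
      (h1.2 h2.1 (Ideal.comap_mono hle)))
    exact this ▸ hM
  have hred : IsReduced (FractionRing R) :=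
    inferInstance
  have hinf : (⨅ m : MaximalSpectrum (FractionRing R), m.asIdeal) = ⊥ := by
    rw [eq_bot_iff, ← Ideal.zero_eq_bot, ← nilradical_eq_zero, PrimeSpectrum.nilradical_eq_iInf]
    exact le_iInf fun P => iInf_le (fun m : MaximalSpectrum (FractionRing R) => m.asIdeal)
      ⟨P.asIdeal, hmax _ P.isPrime⟩
  have : ∀ m : MaximalSpectrum (FractionRing R),
      IsSemisimpleRing (FractionRing R ⧸ m.asIdeal) := fun m => by
    let := Ideal.Quotient.field m.asIdeal
    infer_instance
  let e := Ideal.quotientInfRingEquivPiQuotient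
    (fun m : MaximalSpectrum (FractionRing R) => m.asIdeal) fun I _ ↦ I.isCoprime_of_ne
  have e2 := (RingEquiv.quotientBot (FractionRing R)).symm.trans
    ((Ideal.quotEquivOfEq hinf.symm).trans e)
  exact e2.symm.isSemisimpleRing

theorem aux_inter (R : Type u) [CommRing R] [IsReduced R]
    (hfin : (minimalPrimes R).Finite) (hns : ¬ ContainsFieldSummand R)
    (x : R) (hx : ∀ r ∈ R⁰, r ∣ x) : x = 0 := by
  have := aux_semisimple R hfin
  have hinj : Function.Injective (algebraMap R (FractionRing R)) :=
    IsFractionRing.injective R (FractionRing R)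
  let J : Ideal (FractionRing R) :=
    { carrier := {q | ∃ y : R, (∀ r ∈ R⁰, r ∣ y) ∧ algebraMap R _ y = q}
      add_mem' := by
        rintro _ _ ⟨a, ha, rfl⟩ ⟨b, hb, rfl⟩
        exact ⟨a + b, fun r hr => dvd_add (ha r hr) (hb r hr), map_add _ _ _⟩
      zero_mem' := ⟨0, fun r _ => dvd_zero r, map_zero _⟩
      smul_mem' := by
        rintro c _ ⟨a, ha, rfl⟩
        obtain ⟨n, d, rfl⟩ := IsLocalization.exists_mk'_eq R⁰ c
        obtain ⟨a', rfl⟩ := ha d d.2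
        refine ⟨n * a', fun r hr => ?_, ?_⟩
        · obtain ⟨z, hz⟩ := ha (d * r) (mul_mem d.2 hr)
          have : a' = r * z := by
            rw [mul_assoc] at hz
            exact (mul_cancel_left_mem_nonZeroDivisors d.2).1 hz
          exact Dvd.dvd.mul_left ⟨z, this⟩ _
        · rw [smul_eq_mul, map_mul, map_mul, ← mul_assoc, IsLocalization.mk'_spec] }
  by_contra hx0
  rcases IsSemisimpleModule.eq_bot_or_exists_simple_le J with h | ⟨S, hS, hsimp⟩
  · have : algebraMap R (FractionRing R) x ∈ J := ⟨x, hx, rfl⟩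
    rw [h] at this
    exact hx0 (hinj (by simpa using this))
  obtain ⟨e, he, rfl⟩ := IsSemisimpleRing.ideal_eq_span_idempotent S
  obtain ⟨f, -, rfl⟩ := hS (Ideal.mem_span_singleton_self e)
  have hatom := isSimpleModule_iff_isAtom.1 hsimp
  have hff : f * f = f := hinj (by rw [map_mul]; exact he)
  have hf0 : f ≠ 0 := by
    rintro rfl
    exact hatom.1 (by simp)
  apply hns
  refine ⟨R ⧸ Ideal.span {1 - f}, R ⧸ Ideal.span {f}, inferInstance, inferInstance, ?_, ⟨?_⟩⟩
  · have key : ∀ a : R, f * a = 0 → a ∈ Ideal.span {1 - f} := fun a ha =>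
      Ideal.mem_span_singleton.2 ⟨a, by linear_combination ha⟩
    refine ⟨⟨0, 1, fun h => ?_⟩, mul_comm, ?_⟩
    · have : (1 : R) ∈ Ideal.span {1 - f} := Ideal.Quotient.eq_zero_iff_mem.1 h.symm
      obtain ⟨c, hc⟩ := Ideal.mem_span_singleton.1 this
      apply hf0
      linear_combination f * hc - c * hff
    · intro a ha
      obtain ⟨a, rfl⟩ := Ideal.Quotient.mk_surjective a
      have hfa : f * a ≠ 0 := fun h => ha (Ideal.Quotient.eq_zero_iff_mem.2 (key a h))
      have hle : Ideal.span {algebraMap R (FractionRing R) (f * a)} ≤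
          Ideal.span {algebraMap R (FractionRing R) f} := by
        rw [Ideal.span_singleton_le_span_singleton, map_mul]
        exact dvd_mul_right _ _
      have heq := (hatom.le_iff.1 hle).resolve_left (fun h => hfa (hinj (by simpa using h)))
      have hm : algebraMap R (FractionRing R) f ∈
          Ideal.span {algebraMap R (FractionRing R) (f * a)} :=
        heq ▸ Ideal.mem_span_singleton_self _
      obtain ⟨q, hq⟩ := Ideal.mem_span_singleton.1 hm
      obtain ⟨y, -, hy⟩ := J.mul_mem_left q (hS (Ideal.mem_span_singleton_self _))
      have h3 : f = a * y := by
        apply hinj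
        rw [map_mul, hy]
        rw [map_mul] at hq
        linear_combination hq
      refine ⟨Ideal.Quotient.mk _ y, ?_⟩
      rw [← map_mul, ← h3, eq_comm, ← map_one (Ideal.Quotient.mk (Ideal.span {1 - f})),
        Ideal.Quotient.eq]
      exact Ideal.mem_span_singleton_self _
  · exact RingEquiv.ofBijective _ (RingHom.prod_bijective_of_isIdempotentElem
      (e := 1 - f) (f := f) (IsIdempotentElem.one_sub hff) hff (by ring)
      (by linear_combination -hff))

theorem aux_proj (R : Type u) [CommRing R] [IsReduced R]
    (hfin : (minimalPrimes R).Finite) (n : ℕ) (K : Submodule R (Fin n → R)) :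
    ∃ d ∈ R⁰, ∃ P : (Fin n → R) →ₗ[R] (Fin n → R), (∀ v, P v ∈ K) ∧ ∀ v ∈ K, P v = d • v := by
  have := aux_semisimple R hfin
  have hinj : Function.Injective (algebraMap R (FractionRing R)) :=
    IsFractionRing.injective R (FractionRing R)
  let j : (Fin n → R) →ₗ[R] (Fin n → FractionRing R) :=
    (Algebra.linearMap R (FractionRing R)).compLeft (Fin n)
  have hj : Function.Injective j := fun a b h => funext fun i => hinj (congrFun h i)
  let L : Submodule (FractionRing R) (Fin n → FractionRing R) :=
    Submodule.span _ (j '' (K : Set (Fin n → R)))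
  have hL : ∀ x ∈ L, ∃ s ∈ R⁰, ∃ k ∈ K, s • x = j k := by
    intro x hx
    induction hx using Submodule.span_induction with
    | mem x h =>
      obtain ⟨k, hk, rfl⟩ := h
      exact ⟨1, one_mem _, k, hk, one_smul _ _⟩
    | zero => exact ⟨1, one_mem _, 0, K.zero_mem, by simp⟩
    | add x y _ _ hx hy =>
      obtain ⟨s, hs, k, hk, h1⟩ := hx
      obtain ⟨t, ht, l, hl, h2⟩ := hy
      refine ⟨s * t, mul_mem hs ht, t • k + s • l,
        K.add_mem (K.smul_mem _ hk) (K.smul_mem _ hl), ?_⟩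
      rw [map_add, map_smul, map_smul, ← h1, ← h2, smul_add, smul_smul, smul_smul, mul_comm t s]
    | smul c x _ hx =>
      obtain ⟨s, hs, k, hk, h1⟩ := hx
      obtain ⟨m, d, rfl⟩ := IsLocalization.exists_mk'_eq R⁰ c
      refine ⟨d * s, mul_mem d.2 hs, m • k, K.smul_mem _ hk, ?_⟩
      rw [map_smul, ← h1, mul_smul, smul_comm s, ← smul_assoc,
        Algebra.smul_def (d : R) (IsLocalization.mk' (FractionRing R) m d),
        IsLocalization.mk'_spec', algebraMap_smul]
  obtain ⟨h, hh⟩ := IsSemisimpleModule.extension_property L.subtype L.subtype_injective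
    LinearMap.id
  have hh' : ∀ y (hy : y ∈ L), (h y : Fin n → FractionRing R) = y := fun y hy =>
    congrArg Subtype.val (LinearMap.congr_fun hh ⟨y, hy⟩)
  choose s hs k hk hsk using fun i : Fin n => hL _ (h (j (Pi.single i 1))).2
  have hc : ∀ i, ∃ c, ∏ i, s i = s i * c := fun i => Finset.dvd_prod_of_mem s (Finset.mem_univ i)
  choose c hc using hc
  let P : (Fin n → R) →ₗ[R] (Fin n → R) := (Pi.basisFun R (Fin n)).constr R (fun i => c i • k i)
  have hP : ∀ v, j (P v) = (∏ i, s i) • (h (j v) : Fin n → FractionRing R) := by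
    have : j ∘ₗ P = (∏ i, s i) • ((L.subtype ∘ₗ h).restrictScalars R ∘ₗ j) := by
      apply (Pi.basisFun R (Fin n)).ext
      intro i
      have h1 : P (Pi.basisFun R (Fin n) i) = c i • k i := Module.Basis.constr_basis _ _ _ _
      rw [LinearMap.comp_apply, h1, map_smul, ← hsk, LinearMap.smul_apply, hc i, smul_smul,
        mul_comm (c i), Pi.basisFun_apply]
      rfl
    exact fun v => LinearMap.congr_fun this v
  refine ⟨∏ i, s i, prod_mem fun i _ => hs i, P, fun v => ?_, fun v hv => ?_⟩
  · rw [Module.Basis.constr_apply_fintype]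
    exact K.sum_mem fun i _ => K.smul_mem _ (K.smul_mem _ (hk i))
  · apply hj
    rw [hP, hh' _ (Submodule.subset_span ⟨v, hv, rfl⟩), map_smul]

theorem aux_main (R : Type u) [CommRing R] [IsReduced R]
    (hfin : (minimalPrimes R).Finite) (hns : ¬ ContainsFieldSummand R)
    (M : Type u) [AddCommGroup M] [Module R M] [Module.Finite R M]
    (x : M) (hx : ∀ r ∈ R⁰, ∃ y : M, r • y = x) : x = 0 := by
  obtain ⟨n, g, hg⟩ := Module.Finite.exists_fin' R M
  obtain ⟨d, hd, P, hPK, hP⟩ := aux_proj R hfin n (LinearMap.ker g)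
  obtain ⟨v, rfl⟩ := hg x
  have h1 : ∀ r ∈ R⁰, ∃ y k, k ∈ LinearMap.ker g ∧ v = r • y + k := by
    intro r hr
    obtain ⟨y, hy⟩ := hx r hr
    obtain ⟨y, rfl⟩ := hg y
    exact ⟨y, v - r • y, by simp [LinearMap.mem_ker, hy], by simp⟩
  have h2 : d • v - P v = 0 := by
    funext i
    apply aux_inter R hfin hns
    intro r hr
    obtain ⟨y, k, hk, rfl⟩ := h1 r hr
    refine ⟨(d • y - P y) i, ?_⟩
    have : d • (r • y + k) - P (r • y + k) = r • (d • y - P y) := by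
      rw [map_add, map_smul, hP k hk]
      module
    rw [this]; rfl
  obtain ⟨y, k, hk, rfl⟩ := h1 d hd
  have h3 : d • (d • y - P y) = 0 := by
    rw [← h2, map_add, map_smul, hP k hk]
    module
  have h4 : d • y = P y := by
    rw [← sub_eq_zero]
    funext i
    exact (mul_left_mem_nonZeroDivisors_eq_zero_iff hd).1 (congrFun h3 i)
  rw [h4]
  exact (LinearMap.ker g).add_mem (hPK y) hk

theorem aux_tensor (R : Type u) [CommRing R] (M : Type u) [AddCommGroup M] [Module R M] (r : R)
    (m : M) (h : (Ideal.Quotient.mk (Ideal.span {r}) 1) ⊗ₜ[R] m = 0) : ∃ y : M, r • y = m := by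
  let q : (R ⧸ Ideal.span {r}) →ₗ[R] M →ₗ[R] M ⧸ (LinearMap.range (LinearMap.lsmul R M r)) :=
    Submodule.liftQ _ (LinearMap.toSpanSingleton R _ (Submodule.mkQ _)) (by
      rw [Submodule.span_le, Set.singleton_subset_iff]
      ext y
      exact (Submodule.Quotient.mk_eq_zero _).2 ⟨y, rfl⟩)
  have h1 := congrArg (TensorProduct.lift q) h
  rw [TensorProduct.lift.tmul, map_zero] at h1
  have h2 : q (Ideal.Quotient.mk (Ideal.span {r}) 1) m = Submodule.mkQ _ m := by
    change ((1 : R) • (Submodule.mkQ _ : M →ₗ[R] _)) m = _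
    rw [one_smul]
  rw [h2] at h1
  exact (Submodule.Quotient.mk_eq_zero _).1 h1

/-- For `R` reduced with finitely many minimal primes and without a field as a ring
direct summand, the diagonal map `μ : R → ∏_{r ∈ Reg(R)} R/rR` is a pure embedding:
it is injective and `μ ⊗ id_M` is injective for every finitely presented `R`-module `M`. -/
theorem stmt8 (R : Type u) [CommRing R] [IsReduced R]
    (hfin : (minimalPrimes R).Finite) (hns : ¬ ContainsFieldSummand R) :
    Function.Injective (diagMap R) ∧
      ∀ (M : Type u) [AddCommGroup M] [Module R M], Module.FinitePresentation R M →
        Function.Injective (LinearMap.rTensor M (diagMap R)) := by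
  refine ⟨?_, ?_⟩
  · rw [injective_iff_map_eq_zero]
    intro x hx
    apply aux_inter R hfin hns
    intro r hr
    have := congrFun hx ⟨r, hr⟩
    exact Ideal.mem_span_singleton.1 (Ideal.Quotient.eq_zero_iff_mem.1 this)
  · intro M _ _ hM
    have hfg : Module.Finite R M := inferInstance
    rw [injective_iff_map_eq_zero]
    intro t ht
    obtain ⟨m, rfl⟩ := (TensorProduct.lid R M).symm.surjective t
    rw [TensorProduct.lid_symm_apply] at ht ⊢
    suffices m = 0 by rw [this, TensorProduct.tmul_zero]
    apply aux_main R hfin hns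
    intro r hr
    apply aux_tensor
    have h := congrArg (LinearMap.rTensor M (LinearMap.proj (R := R)
      (φ := fun r : nonZeroDivisors R => R ⧸ Ideal.span {(r : R)}) ⟨r, hr⟩)) ht
    rw [map_zero, LinearMap.rTensor_tmul, LinearMap.rTensor_tmul] at h
    exact h
end

section
/- Let R be a commutative ring whose total ring of quotients is semisimple, and let M be a Baer R-module (Ext^1_R(M, T) = 0 for every torsion R-module T). Then M has projective dimension at most 1. -/
open CategoryTheory

universe u

/-- `Ext^n_R(M, N)` via the derived functor `Ext` on `ModuleCat R`. -/
abbrev extGroup (R : Type u) [CommRing R] (n : ℕ) (M N : Type u)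
    [AddCommGroup M] [Module R M] [AddCommGroup N] [Module R N] : Type u :=
  ((Ext R (ModuleCat.{u} R) n).obj (Opposite.op (ModuleCat.of R M))).obj (ModuleCat.of R N)

open Limits

section Aux

/-- Every `n+1`-cocycle with values in `X` is a coboundary. -/
def Stmt10Fac {R : Type u} [CommRing R] {M : ModuleCat.{u} R} (P : ProjectiveResolution M) (n : ℕ)
    (X : ModuleCat.{u} R) : Prop :=
  ∀ f : P.complex.X (n + 1) ⟶ X, P.complex.d (n + 2) (n + 1) ≫ f = 0 →
    ∃ g : P.complex.X n ⟶ X, P.complex.d (n + 1) n ≫ g = f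

theorem stmt10_fac_iff {R : Type u} [CommRing R] {M : ModuleCat.{u} R}
    (P : ProjectiveResolution M) (n : ℕ) (X : ModuleCat.{u} R) :
    Subsingleton (((Ext R (ModuleCat.{u} R) (n + 1)).obj (Opposite.op M)).obj X) ↔
      Stmt10Fac P n X := by
  rw [← ModuleCat.isZero_iff_subsingleton, (P.isoExt (n + 1) X).isZero_iff,
    ← HomologicalComplex.exactAt_iff_isZero_homology,
    HomologicalComplex.exactAt_iff' _ n (n + 1) (n + 2) (by simp) (by simp),
    ShortComplex.moduleCat_exact_iff]
  exact Iff.rfl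

theorem stmt10_fac_mid {R : Type u} [CommRing R] {M : ModuleCat.{u} R}
    (P : ProjectiveResolution M) (n : ℕ) (S : ShortComplex (ModuleCat.{u} R)) (hS : S.ShortExact)
    (h1 : Stmt10Fac P n S.X₁) (h3 : Stmt10Fac P n S.X₃) : Stmt10Fac P n S.X₂ := by
  intro f hf
  have := hS.mono_f
  have := hS.epi_g
  obtain ⟨h, hh⟩ := h3 (f ≫ S.g) (by rw [← Category.assoc, hf, zero_comp])
  let h' := Projective.factorThru h S.g
  have hh' : h' ≫ S.g = h := Projective.factorThru_comp _ _
  let c := hS.exact.liftFromProjective (f - P.complex.d (n + 1) n ≫ h')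
    (by simp [Preadditive.sub_comp, hh', hh])
  have hc : c ≫ S.f = f - P.complex.d (n + 1) n ≫ h' := hS.exact.liftFromProjective_comp _ _
  obtain ⟨k, hk⟩ := h1 c (by
    rw [← cancel_mono S.f, Category.assoc, hc]
    simp [Preadditive.comp_sub, hf])
  refine ⟨k ≫ S.f + h', ?_⟩
  rw [Preadditive.comp_add, ← Category.assoc, hk, hc]
  simp

theorem stmt10_fac_inj {R : Type u} [CommRing R] {M : ModuleCat.{u} R}
    (P : ProjectiveResolution M) (n : ℕ) (X : ModuleCat.{u} R) [Injective X] :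
    Stmt10Fac P n X := by
  intro f hf
  exact ⟨(P.exact_succ n).descToInjective f hf, (P.exact_succ n).comp_descToInjective _ _⟩

theorem stmt10_fac_shift {R : Type u} [CommRing R] {M : ModuleCat.{u} R}
    (P : ProjectiveResolution M) (n : ℕ) (S : ShortComplex (ModuleCat.{u} R)) (hS : S.ShortExact)
    [Injective S.X₂] (h3 : Stmt10Fac P n S.X₃) : Stmt10Fac P (n + 1) S.X₁ := by
  intro f hf
  have := hS.mono_f
  have := hS.epi_g
  obtain ⟨g, hg⟩ := stmt10_fac_inj P (n + 1) S.X₂ (f ≫ S.f)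
    (by rw [← Category.assoc, hf, zero_comp])
  obtain ⟨h, hh⟩ := h3 (g ≫ S.g) (by rw [← Category.assoc, hg]; simp)
  let h' := Projective.factorThru h S.g
  have hh' : h' ≫ S.g = h := Projective.factorThru_comp _ _
  let c := hS.exact.liftFromProjective (g - P.complex.d (n + 1) n ≫ h')
    (by simp [Preadditive.sub_comp, hh', hh])
  have hc : c ≫ S.f = g - P.complex.d (n + 1) n ≫ h' := hS.exact.liftFromProjective_comp _ _
  refine ⟨c, ?_⟩
  rw [← cancel_mono S.f, Category.assoc, hc]
  simp [Preadditive.comp_sub, hg]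

/-- A module on which regular elements act bijectively is injective. -/
theorem stmt10_injective (R : Type u) [CommRing R] (h : IsSemisimpleRing (FractionRing R))
    (V : Type u) [AddCommGroup V] [Module R V]
    (hV : ∀ s : nonZeroDivisors R, Function.Bijective fun v : V => (s : R) • v) :
    Module.Injective R V where
  out X Y _ _ _ _ f hf g := by
    have : IsLocalizedModule (nonZeroDivisors R) (LinearMap.id : V →ₗ[R] V) :=
      { map_units := fun s => (Module.End.isUnit_iff _).2 (hV s)
        surj := fun y => ⟨(y, 1), by simp⟩
        exists_of_eq := fun e => ⟨1, by simpa using e⟩ }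
    let S := nonZeroDivisors R
    let jX := LocalizedModule.mkLinearMap S X
    let jY := LocalizedModule.mkLinearMap S Y
    let jV := LocalizedModule.mkLinearMap S V
    let F : LocalizedModule S X →ₗ[FractionRing R] LocalizedModule S Y :=
      IsLocalizedModule.mapExtendScalars S jX jY (FractionRing R) f
    let G : LocalizedModule S X →ₗ[FractionRing R] LocalizedModule S V :=
      IsLocalizedModule.mapExtendScalars S jX jV (FractionRing R) g
    have hF : Function.Injective F := IsLocalizedModule.map_injective S jX jY f hf
    obtain ⟨k, hk⟩ := (Module.injective_of_isSemisimpleRing (FractionRing R)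
      (LocalizedModule S V)).out F hF G
    let e : V ≃ₗ[R] LocalizedModule S V := IsLocalizedModule.linearEquiv S LinearMap.id jV
    have he (v : V) : e v = jV v := IsLocalizedModule.linearEquiv_apply S LinearMap.id jV v
    refine ⟨e.symm.toLinearMap ∘ₗ k.restrictScalars R ∘ₗ jY, fun x => ?_⟩
    have h1 : F (jX x) = jY (f x) := IsLocalizedModule.map_apply S jX jY f x
    have h2 : G (jX x) = jV (g x) := IsLocalizedModule.map_apply S jX jV g x
    have h3 : k (jY (f x)) = jV (g x) := by rw [← h1, hk, h2]
    change e.symm (k (jY (f x))) = g x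
    rw [h3, ← he, e.symm_apply_apply]

theorem stmt10_divisible (R : Type u) [CommRing R] (E : Type u) [AddCommGroup E] [Module R E]
    [hE : Module.Injective R E] (s : nonZeroDivisors R) (e : E) : ∃ e' : E, (s : R) • e' = e := by
  obtain ⟨k, hk⟩ := hE.out (LinearMap.mulLeft R (s : R))
    (fun a b hab => by
      have hab : (s : R) * a = s * b := hab
      exact (mul_cancel_left_mem_nonZeroDivisors s.2).1 hab)
    (LinearMap.toSpanSingleton R E e)
  refine ⟨k 1, ?_⟩
  have := hk 1
  simp only [LinearMap.mulLeft_apply, LinearMap.toSpanSingleton_apply, one_smul] at this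
  rw [← this, ← map_smul, smul_eq_mul]

theorem stmt10_quot_injective (R : Type u) [CommRing R] (h : IsSemisimpleRing (FractionRing R))
    (D : Type u) [AddCommGroup D] [Module R D]
    (hD : ∀ (s : nonZeroDivisors R) (d : D), ∃ d' : D, (s : R) • d' = d) :
    Module.Injective R (D ⧸ Submodule.torsion R D) := by
  refine stmt10_injective R h _ fun s => ⟨?_, ?_⟩
  · refine (injective_iff_map_eq_zero (DistribSMul.toAddMonoidHom _ (s : R))).2 fun v hv => ?_
    have : v ∈ Submodule.torsion R (D ⧸ Submodule.torsion R D) :=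
      (Submodule.mem_torsion_iff v).2 ⟨s, hv⟩
    rwa [Submodule.QuotientTorsion.torsion_eq_bot] at this
  · intro v
    obtain ⟨d, rfl⟩ := Submodule.mkQ_surjective _ v
    obtain ⟨d', rfl⟩ := hD s d
    exact ⟨Submodule.mkQ _ d', by simp⟩

end Aux

/-- If the total ring of quotients of `R` is semisimple and `M` is a Baer `R`-module,
then `M` has projective dimension at most `1`, i.e. `Ext^2_R(M, N) = 0` for all `N`. -/
theorem stmt10 (R : Type u) [CommRing R] (h : IsSemisimpleRing (FractionRing R))
    (M : Type u) [AddCommGroup M] [Module R M]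
    (hB : ∀ (T : Type u) [AddCommGroup T] [Module R T], Module.IsTorsion R T →
      Subsingleton (extGroup R 1 M T)) :
    ∀ (N : Type u) [AddCommGroup N] [Module R N], Subsingleton (extGroup R 2 M N) := by
  intro N _ _
  let P := projectiveResolution (ModuleCat.of R M)
  refine (stmt10_fac_iff P 1 (ModuleCat.of R N)).2 ?_
  let ι := Injective.ι (ModuleCat.of R N)
  let S : ShortComplex (ModuleCat.{u} R) := ShortComplex.mk ι (cokernel.π ι) (by simp)
  have hS : S.ShortExact :=
    { exact := ShortComplex.exact_cokernel ι
      mono_f := inferInstanceAs (Mono ι)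
      epi_g := inferInstanceAs (Epi (cokernel.π ι)) }
  have : Injective S.X₂ := inferInstanceAs (Injective (Injective.under (ModuleCat.of R N)))
  refine stmt10_fac_shift P 0 S hS ?_
  have : Module.Injective R S.X₂ :=
    have : Injective (ModuleCat.of R S.X₂) := ‹Injective S.X₂›
    Module.injective_module_of_injective_object R S.X₂
  have hD : ∀ (s : nonZeroDivisors R) (d : S.X₃), ∃ d' : S.X₃, (s : R) • d' = d := by
    intro s d
    obtain ⟨e, rfl⟩ := hS.moduleCat_surjective_g d
    obtain ⟨e', rfl⟩ := stmt10_divisible R S.X₂ s e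
    exact ⟨S.g e', by simp⟩
  let A := Submodule.torsion R S.X₃
  let S' : ShortComplex (ModuleCat.{u} R) :=
    ShortComplex.mk (ModuleCat.ofHom A.subtype) (ModuleCat.ofHom A.mkQ) (by ext x; simp)
  have hS' : S'.ShortExact :=
    { exact := by
        rw [ShortComplex.moduleCat_exact_iff_range_eq_ker]
        simp [S']
      mono_f := (ModuleCat.mono_iff_injective _).2 A.subtype_injective
      epi_g := (ModuleCat.epi_iff_surjective _).2 A.mkQ_surjective }
  refine stmt10_fac_mid P 0 S' hS' ?_ ?_
  · exact (stmt10_fac_iff P 0 (ModuleCat.of R A)).1 (hB A Submodule.torsion_isTorsion)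
  · have := stmt10_quot_injective R h S.X₃ hD
    have : Injective S'.X₃ := Module.injective_object_of_injective_module R (S.X₃ ⧸ A)
    exact stmt10_fac_inj P 0 S'.X₃
end

section
/- Let R be a commutative ring whose total ring of quotients is semisimple. Then every Baer R-module is projective. -/
open CategoryTheory

universe u

/-- Extension property of a submodule with respect to a target. -/
def ExtPair {R : Type u} [CommRing R] {F : Type u} [AddCommGroup F] [Module R F]
    (K : Submodule R F) (T : Type u) [AddCommGroup T] [Module R T] : Prop :=
  ∀ e : K →ₗ[R] T, ∃ g : F →ₗ[R] T, ∀ k : K, g k = e k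

def BaerPair {R : Type u} [CommRing R] {F : Type u} [AddCommGroup F] [Module R F]
    (K : Submodule R F) : Prop :=
  ∀ (T : Type u) [AddCommGroup T] [Module R T], Module.IsTorsion R T → ExtPair K T

/-- vanishing of Ext gives an extension property for one projective presentation. -/
theorem ext_extend (R : Type u) [CommRing R] (B T : Type u) [AddCommGroup B] [Module R B]
    [AddCommGroup T] [Module R T] (h : Subsingleton (extGroup R 1 B T)) :
    ∃ (P : ModuleCat.{u} R) (p : P →ₗ[R] B), Module.Projective R P ∧ Function.Surjective p ∧
      ExtPair (LinearMap.ker p) T := by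
  obtain ⟨Pr⟩ := (inferInstance : HasProjectiveResolution (ModuleCat.of R B)).out
  have hz : Limits.IsZero ((Pr.complex.linearYonedaObj R (ModuleCat.of R T)).homology 1) := by
    refine Limits.IsZero.of_iso ?_ (Pr.isoExt (R := R) 1 (ModuleCat.of R T)).symm
    exact ModuleCat.isZero_of_subsingleton _
  rw [← HomologicalComplex.exactAt_iff_isZero_homology,
    HomologicalComplex.exactAt_iff' _ 0 1 2 (by simp) (by simp)] at hz
  rw [ShortComplex.moduleCat_exact_iff] at hz
  have hex := Pr.exact₀
  rw [ShortComplex.moduleCat_exact_iff] at hex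
  have hepi : Epi (Pr.π.f 0) := inferInstance
  have hsurj : Function.Surjective (Pr.π.f 0).hom := (ModuleCat.epi_iff_surjective _).1 hepi
  have hproj : Projective (Pr.complex.X 0) := inferInstance
  refine ⟨Pr.complex.X 0, (Pr.π.f 0).hom, ?_, hsurj, ?_⟩
  · exact (IsProjective.iff_projective _ ).2 hproj
  intro e
  let d : Pr.complex.X 1 →ₗ[R] Pr.complex.X 0 := (Pr.complex.d 1 0).hom
  let d2 : Pr.complex.X 2 →ₗ[R] Pr.complex.X 1 := (Pr.complex.d 2 1).hom
  have hd : ∀ z, d z ∈ LinearMap.ker (Pr.π.f 0).hom := by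
    intro z
    rw [LinearMap.mem_ker]
    have := Pr.complex_d_comp_π_f_zero
    exact congrArg (fun f => f.hom z) this
  have hdd : ∀ z, d (d2 z) = 0 := by
    intro z
    have := Pr.complex.d_comp_d 2 1 0
    exact congrArg (fun f => f.hom z) this
  let φ : Pr.complex.X 1 ⟶ ModuleCat.of R T := ModuleCat.ofHom (e ∘ₗ d.codRestrict _ hd)
  obtain ⟨ψ, hψ⟩ := hz φ (by
    change Pr.complex.d 2 1 ≫ φ = 0
    ext z
    change e (d.codRestrict _ hd (d2 z)) = 0
    have : d.codRestrict _ hd (d2 z) = 0 := Subtype.ext (hdd z)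
    rw [this]; exact LinearMap.map_zero e)
  let ψ' : Pr.complex.X 0 ⟶ ModuleCat.of R T := ψ
  have hψ' : Pr.complex.d 1 0 ≫ ψ' = φ := hψ
  refine ⟨ψ'.hom, ?_⟩
  rintro ⟨k, hk⟩
  obtain ⟨z, hz'⟩ := hex k hk
  have h1 : ψ'.hom (d z)
      = e (d.codRestrict _ hd z) := congrArg (fun f => f.hom z) hψ'
  have h2 : d z = k := hz'
  have h3 : d.codRestrict _ hd z = ⟨k, hk⟩ := Subtype.ext h2
  rw [h3, h2] at h1
  exact h1

theorem baerPair_of_ext (R : Type u) [CommRing R] (B F : Type u) [AddCommGroup B] [Module R B]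
    [AddCommGroup F] [Module R F] [Module.Projective R F]
    (hB : ∀ (T : Type u) [AddCommGroup T] [Module R T], Module.IsTorsion R T →
      Subsingleton (extGroup R 1 B T)) (q : F →ₗ[R] B) (hq : Function.Surjective q) :
    BaerPair (LinearMap.ker q) := by
  intro T _ _ hT e
  obtain ⟨P, p, hP, hp, hext⟩ := ext_extend R B T (hB T hT)
  obtain ⟨a, ha⟩ := Module.projective_lifting_property q p hq
  obtain ⟨b, hb⟩ := Module.projective_lifting_property p q hp
  have ha' : ∀ x, q (a x) = p x := fun x => LinearMap.congr_fun ha x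
  have hb' : ∀ x, p (b x) = q x := fun x => LinearMap.congr_fun hb x
  let a' : LinearMap.ker p →ₗ[R] LinearMap.ker q :=
    (a ∘ₗ (LinearMap.ker p).subtype).codRestrict _ (by
      rintro ⟨x, hx⟩
      simpa [ha'] using hx)
  obtain ⟨ψ, hψ⟩ := hext (e ∘ₗ a')
  let c : F →ₗ[R] LinearMap.ker q :=
    (LinearMap.id - a ∘ₗ b).codRestrict _ (by
      intro x
      simp [ha', hb'])
  refine ⟨e ∘ₗ c + ψ ∘ₗ b, ?_⟩
  rintro ⟨k, hk⟩
  have hbk : b k ∈ LinearMap.ker p := by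
    rw [LinearMap.mem_ker, hb']; exact hk
  have h1 := hψ ⟨b k, hbk⟩
  simp only [LinearMap.add_apply, LinearMap.comp_apply] at h1 ⊢
  rw [h1, ← map_add]
  congr 1
  apply Subtype.ext
  simp [c, a']


open nonZeroDivisors in
theorem extPair_of_bijective {R : Type u} [CommRing R] (h : IsSemisimpleRing (FractionRing R))
    {F : Type u} [AddCommGroup F] [Module R F] (K : Submodule R F)
    (D : Type u) [AddCommGroup D] [Module R D]
    (hD : ∀ s ∈ nonZeroDivisors R, Function.Bijective (fun x : D => s • x)) : ExtPair K D := by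
  intro e
  let S := nonZeroDivisors R
  have hi : Function.Injective (LocalizedModule.map S K.subtype) :=
    LocalizedModule.map_injective S _ K.injective_subtype
  haveI : IsSemisimpleRing (Localization S) := h
  obtain ⟨g, hg⟩ := IsSemisimpleModule.extension_property _ hi (LocalizedModule.map S e)
  have hu : ∀ x : S, IsUnit ((algebraMap R (Module.End R D)) x) := by
    intro x
    rw [Module.End.isUnit_iff]
    exact hD x x.2
  let l : LocalizedModule S D →ₗ[R] D := LocalizedModule.lift S LinearMap.id hu
  refine ⟨l ∘ₗ (g.restrictScalars R) ∘ₗ LocalizedModule.mkLinearMap S F, ?_⟩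
  intro k
  have h1 := LinearMap.congr_fun hg (LocalizedModule.mk k 1)
  simp only [LinearMap.comp_apply, LocalizedModule.map_mk] at h1
  simp only [LinearMap.comp_apply, LinearMap.restrictScalars_apply,
    LocalizedModule.mkLinearMap_apply]
  change l (g (LocalizedModule.mk (K.subtype k) 1)) = e k
  rw [h1]
  have := LinearMap.congr_fun (LocalizedModule.lift_comp S (LinearMap.id : D →ₗ[R] D) hu) (e k)
  exact this

theorem extPair_of_divisible {R : Type u} [CommRing R] (h : IsSemisimpleRing (FractionRing R))
    {F : Type u} [AddCommGroup F] [Module R F] [Module.Projective R F] (K : Submodule R F)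
    (hK : BaerPair K)
    (D : Type u) [AddCommGroup D] [Module R D]
    (hD : ∀ s ∈ nonZeroDivisors R, Function.Surjective (fun x : D => s • x)) : ExtPair K D := by
  intro e
  let T := Submodule.torsion R D
  have hDT : ∀ s ∈ nonZeroDivisors R, Function.Bijective (fun x : D ⧸ T => s • x) := by
    intro s hs
    constructor
    · intro x y hxy
      obtain ⟨x, rfl⟩ := T.mkQ_surjective x
      obtain ⟨y, rfl⟩ := T.mkQ_surjective y
      simp only [← map_smul] at hxy
      simp only [Submodule.mkQ_apply] at hxy ⊢
      rw [Submodule.Quotient.eq] at hxy ⊢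
      rw [← smul_sub] at hxy
      obtain ⟨a, ha⟩ := (Submodule.mem_torsion_iff _).1 hxy
      refine (Submodule.mem_torsion_iff _).2 ⟨a * ⟨s, hs⟩, ?_⟩
      rw [mul_smul]
      exact ha
    · intro x
      obtain ⟨x, rfl⟩ := T.mkQ_surjective x
      obtain ⟨y, hy⟩ := hD s hs x
      refine ⟨T.mkQ y, ?_⟩
      simp only at hy ⊢
      rw [← map_smul, hy]
  obtain ⟨g0, hg0⟩ := extPair_of_bijective h K (D ⧸ T) hDT (T.mkQ ∘ₗ e)
  obtain ⟨g1, hg1⟩ := Module.projective_lifting_property T.mkQ g0 T.mkQ_surjective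
  have hdiff : ∀ k : K, (e - g1 ∘ₗ K.subtype) k ∈ T := by
    intro k
    have h1 := LinearMap.congr_fun hg1 k
    rw [hg0 k] at h1
    simp only [LinearMap.comp_apply, Submodule.mkQ_apply] at h1
    have := (Submodule.Quotient.eq T).1 h1.symm
    simpa using this
  obtain ⟨g2, hg2⟩ := hK T (Submodule.torsion_isTorsion)
    ((e - g1 ∘ₗ K.subtype).codRestrict T hdiff)
  refine ⟨g1 + T.subtype ∘ₗ g2, ?_⟩
  intro k
  simp [hg2]

theorem exists_injective_embedding {R : Type u} [CommRing R] (M : Type u) [AddCommGroup M]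
    [Module R M] : ∃ (E : ModuleCat.{u} R) (i : M →ₗ[R] E), Module.Injective R E ∧
      Function.Injective i := by
  obtain ⟨⟨J, hJ, f, hf⟩⟩ := (inferInstance : EnoughInjectives (ModuleCat.{u} R)).presentation
    (ModuleCat.of R M)
  exact ⟨J, f.hom, (Module.injective_iff_injective_object R J).2 hJ,
    (ModuleCat.mono_iff_injective f).1 hf⟩

theorem divisible_of_injective {R : Type u} [CommRing R] (E : Type u) [AddCommGroup E]
    [Module R E] [Module.Injective R E] :
    ∀ s ∈ nonZeroDivisors R, Function.Surjective (fun x : E => s • x) := by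
  intro s hs x
  have hinj : Function.Injective (LinearMap.mulLeft R s) := by
    intro a b hab
    simp only [LinearMap.mulLeft_apply] at hab
    exact (mem_nonZeroDivisors_iff.1 hs).1 |> fun H => by
      have : s * (a - b) = 0 := by rw [mul_sub, hab, sub_self]
      exact sub_eq_zero.1 (H _ this)
  obtain ⟨g, hg⟩ := Module.Injective.out (LinearMap.mulLeft R s) hinj
    (LinearMap.toSpanSingleton R E x)
  refine ⟨g 1, ?_⟩
  have := hg 1
  simp only [LinearMap.mulLeft_apply, mul_one, LinearMap.toSpanSingleton_apply, one_smul] at this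
  simp only
  rw [← map_smul, smul_eq_mul, mul_one, this]

theorem projective_of_baerPair {R : Type u} [CommRing R] (h : IsSemisimpleRing (FractionRing R))
    {F : Type u} [AddCommGroup F] [Module R F] [Module.Projective R F] (K : Submodule R F)
    (hK : BaerPair K) : Module.Projective R K := by
  apply Module.Projective.of_lifting_property''
  intro p hp
  obtain ⟨E, i, hE, hi⟩ := exists_injective_embedding (R := R) (K →₀ R)
  let N : Submodule R E := (LinearMap.ker p).map i
  have hdiv : ∀ s ∈ nonZeroDivisors R, Function.Surjective (fun x : E ⧸ N => s • x) := by
    intro s hs x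
    obtain ⟨x, rfl⟩ := N.mkQ_surjective x
    obtain ⟨y, hy⟩ := divisible_of_injective (R := R) E s hs x
    exact ⟨N.mkQ y, by simp only at hy ⊢; rw [← map_smul, hy]⟩
  let e0 : ((K →₀ R) ⧸ LinearMap.ker p) →ₗ[R] E ⧸ N :=
    Submodule.mapQ _ _ i (Submodule.le_comap_map _ _)
  let q : ((K →₀ R) ⧸ LinearMap.ker p) ≃ₗ[R] K := LinearMap.quotKerEquivOfSurjective p hp
  obtain ⟨g0, hg0⟩ := extPair_of_divisible h K hK (E ⧸ N) hdiv (e0 ∘ₗ q.symm.toLinearMap)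
  obtain ⟨g, hg⟩ := Module.projective_lifting_property N.mkQ g0 N.mkQ_surjective
  have key : ∀ k : K, ∃ m : K →₀ R, i m = g k ∧ p m = k := by
    intro k
    obtain ⟨m, hm⟩ := hp k
    have h1 := LinearMap.congr_fun hg k
    rw [hg0 k] at h1
    have h2 : q.symm k = Submodule.Quotient.mk m := by
      rw [LinearEquiv.symm_apply_eq, ← hm]
      rfl
    simp only [LinearMap.comp_apply, LinearEquiv.coe_coe, h2] at h1
    have h3 : N.mkQ (g k) = N.mkQ (i m) := h1
    simp only [Submodule.mkQ_apply] at h3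
    rw [Submodule.Quotient.eq] at h3
    obtain ⟨n, hn, hn'⟩ := h3
    refine ⟨n + m, ?_, ?_⟩
    · rw [map_add, hn']; simp
    · rw [map_add, hm, LinearMap.mem_ker.1 hn, zero_add]
  let j : (K →₀ R) ≃ₗ[R] LinearMap.range i := LinearEquiv.ofInjective i hi
  have hr : ∀ k : K, (g ∘ₗ K.subtype) k ∈ LinearMap.range i := by
    intro k
    obtain ⟨m, hm, _⟩ := key k
    exact ⟨m, hm⟩
  refine ⟨j.symm.toLinearMap ∘ₗ (g ∘ₗ K.subtype).codRestrict _ hr, ?_⟩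
  ext1 k
  obtain ⟨m, hm, hm'⟩ := key k
  have : j.symm ((g ∘ₗ K.subtype).codRestrict _ hr k) = m := by
    rw [LinearEquiv.symm_apply_eq]
    apply Subtype.ext
    exact hm.symm
  simp only [LinearMap.comp_apply, LinearEquiv.coe_coe, LinearMap.id_apply]
  rw [this, hm']

theorem exists_tau {R : Type u} [CommRing R] (h : IsSemisimpleRing (FractionRing R))
    {F : Type u} [AddCommGroup F] [Module R F] [Module.Projective R F] (K : Submodule R F)
    (hK : BaerPair K) : ∃ τ : K →ₗ[R] (K →₀ R),
      ∀ k, Finsupp.linearCombination R (id : K → K) (τ k) = k := by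
  have := projective_of_baerPair h K hK
  obtain ⟨s, hs⟩ := this.out
  exact ⟨s, hs⟩


/-- coordinatewise map to the total quotient ring -/
noncomputable def coordQ (R : Type u) [CommRing R] (ι : Type*) :
    (ι → R) →ₗ[R] (ι → FractionRing R) :=
  LinearMap.pi fun i => (Algebra.linearMap R (FractionRing R)) ∘ₗ LinearMap.proj i

theorem coordQ_apply (R : Type u) [CommRing R] (ι : Type*) (v : ι → R) (i : ι) :
    coordQ R ι v i = algebraMap R (FractionRing R) (v i) := rfl

theorem coordQ_injective (R : Type u) [CommRing R] (ι : Type*) :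
    Function.Injective (coordQ R ι) := by
  intro v w hvw
  funext i
  exact IsFractionRing.injective R (FractionRing R) (congrFun hvw i)

theorem mem_span_coordQ {R : Type u} [CommRing R] {ι : Type*} (W : Submodule R (ι → R))
    {x : ι → FractionRing R} (hx : x ∈ Submodule.span (FractionRing R) (coordQ R ι '' W)) :
    ∃ s ∈ nonZeroDivisors R, ∃ w ∈ W, s • x = coordQ R ι w := by
  induction hx using Submodule.span_induction with
  | mem x hx =>
    obtain ⟨w, hw, rfl⟩ := hx
    exact ⟨1, one_mem _, w, hw, one_smul _ _⟩
  | zero => exact ⟨1, one_mem _, 0, W.zero_mem, by simp⟩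
  | add x y _ _ hx hy =>
    obtain ⟨s, hs, w, hw, h1⟩ := hx
    obtain ⟨t, ht, v, hv, h2⟩ := hy
    refine ⟨s * t, mul_mem hs ht, t • w + s • v, W.add_mem (W.smul_mem _ hw) (W.smul_mem _ hv), ?_⟩
    rw [map_add, map_smul, map_smul, ← h1, ← h2, smul_add, mul_smul, mul_smul, smul_comm s t x]
  | smul a x _ hx =>
    obtain ⟨s, hs, w, hw, h1⟩ := hx
    obtain ⟨⟨b, t⟩, hbt⟩ := IsLocalization.surj (nonZeroDivisors R) a
    refine ⟨t * s, mul_mem t.2 hs, b • w, W.smul_mem _ hw, ?_⟩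
    rw [map_smul, ← h1]
    funext i
    simp only [Pi.smul_apply]
    simp only at hbt
    rw [smul_eq_mul, Algebra.smul_def, Algebra.smul_def, Algebra.smul_def, map_mul, ← hbt]
    ring

theorem coordQ_mem_span {R : Type u} [CommRing R] {ι : Type*} (W : Submodule R (ι → R))
    {v : ι → R} (hv : ∃ s ∈ nonZeroDivisors R, s • v ∈ W) :
    coordQ R ι v ∈ Submodule.span (FractionRing R) (coordQ R ι '' W) := by
  obtain ⟨s, hs, hsv⟩ := hv
  have hu : IsUnit (algebraMap R (FractionRing R) s) :=
    IsLocalization.map_units (FractionRing R) (⟨s, hs⟩ : nonZeroDivisors R)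
  have h1 : coordQ R ι (s • v) ∈ Submodule.span (FractionRing R) (coordQ R ι '' W) :=
    Submodule.subset_span ⟨_, hsv, rfl⟩
  rw [map_smul] at h1
  obtain ⟨a, ha⟩ := hu.exists_left_inv
  have h2 := Submodule.smul_mem _ a h1
  convert h2 using 1
  funext i
  simp only [Pi.smul_apply]
  rw [smul_eq_mul, Algebra.smul_def, ← mul_assoc, ha, one_mul]

theorem lattice_approx {R : Type u} [CommRing R] (h : IsSemisimpleRing (FractionRing R))
    {ι : Type*} [Finite ι] (W : Submodule R (ι → R)) :
    ∃ r ∈ nonZeroDivisors R, ∃ w : ι → ι → R, (∀ j, w j ∈ W) ∧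
      ∀ v : ι → R, (∃ s ∈ nonZeroDivisors R, s • v ∈ W) →
        ∀ [Fintype ι], r • v = ∑ j, v j • w j := by
  classical
  have := Fintype.ofFinite ι
  let V := Submodule.span (FractionRing R) (coordQ R ι '' W)
  obtain ⟨P, hP⟩ := IsSemisimpleModule.extension_property V.subtype V.injective_subtype
    (LinearMap.id)
  have h1 : ∀ j : ι, ∃ s ∈ nonZeroDivisors R, ∃ w ∈ W,
      s • (P (Pi.single j 1) : ι → FractionRing R) = coordQ R ι w := fun j =>
    mem_span_coordQ W (P (Pi.single j 1)).2
  choose s hs w hw hsw using h1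
  refine ⟨∏ j, s j, prod_mem fun j _ => hs j, fun j => (∏ i ∈ Finset.univ.erase j, s i) • w j,
    fun j => W.smul_mem _ (hw j), ?_⟩
  intro v hv inst
  have hinst : inst = this := Subsingleton.elim _ _
  subst hinst
  apply coordQ_injective
  have hmem := coordQ_mem_span W hv
  have h2 : (P (coordQ R ι v) : ι → FractionRing R) = coordQ R ι v := by
    have := LinearMap.congr_fun hP ⟨_, hmem⟩
    exact congrArg Subtype.val this
  have h3 : coordQ R ι v = ∑ j, v j • (Pi.single j (1 : FractionRing R) : ι → FractionRing R) := by
    funext i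
    simp [coordQ_apply, Finset.sum_apply, Pi.single_apply, Algebra.smul_def]
  rw [map_smul, ← h2]
  conv_lhs => rw [h3]
  simp only [map_sum, map_smul, Submodule.coe_sum, Finset.smul_sum, ← hsw]
  apply Finset.sum_congr rfl
  intro j _
  have h4 : (P (v j • (Pi.single j (1 : FractionRing R) : ι → FractionRing R)) :
      ι → FractionRing R) = v j • (P (Pi.single j (1 : FractionRing R)) : ι → FractionRing R) := by
    rw [← LinearMap.coe_restrictScalars R, map_smul]; rfl
  rw [← Finset.mul_prod_erase _ _ (Finset.mem_univ j), h4, smul_smul, smul_smul, smul_smul]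
  congr 1
  ring

theorem lattice_stabilize {R : Type u} [CommRing R] (h : IsSemisimpleRing (FractionRing R))
    {ι : Type*} [Finite ι] (W : ℕ → Submodule R (ι → R)) (hW : Antitone W) :
    ∃ n, ∀ m, n ≤ m → ∀ v ∈ W n, ∃ s ∈ nonZeroDivisors R, s • v ∈ W m := by
  let f : ℕ →o (Submodule (FractionRing R) (ι → FractionRing R))ᵒᵈ :=
    ⟨fun n => OrderDual.toDual (Submodule.span (FractionRing R) (coordQ R ι '' W n)), by
      intro a b hab
      exact Submodule.span_mono (Set.image_mono (hW hab))⟩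
  obtain ⟨n, hn⟩ := IsArtinian.monotone_stabilizes f
  refine ⟨n, fun m hm v hv => ?_⟩
  have h1 : coordQ R ι v ∈ Submodule.span (FractionRing R) (coordQ R ι '' W n) :=
    Submodule.subset_span ⟨v, hv, rfl⟩
  have h2 : Submodule.span (FractionRing R) (coordQ R ι '' W n)
    = Submodule.span (FractionRing R) (coordQ R ι '' W m) := hn m hm
  rw [h2] at h1
  obtain ⟨s, hs, w, hw, hsw⟩ := mem_span_coordQ _ h1
  refine ⟨s, hs, ?_⟩
  rw [← map_smul] at hsw
  rw [coordQ_injective _ _ hsw]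
  exact hw

theorem finite_support {R : Type u} [CommRing R] (h : IsSemisimpleRing (FractionRing R))
    {X Y : Type u} (K : Submodule R (X →₀ R)) (τ : K →ₗ[R] (Y →₀ R)) (Z : Finset X) :
    ∃ A : Finset Y, ∀ k : K, (∀ x, (k : X →₀ R) x ≠ 0 → x ∈ Z) → (τ k).support ⊆ A := by
  classical
  let ρ : (X →₀ R) →ₗ[R] (Z → R) := LinearMap.pi fun z => Finsupp.lapply z.1
  let KZ : Submodule R (X →₀ R) := K ⊓ Finsupp.supported R R (Z : Set X)
  obtain ⟨r, hr, w, hw, hall⟩ := lattice_approx h (KZ.map ρ)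
  have h1 : ∀ j : Z, ∃ k : K, (k : X →₀ R) ∈ Finsupp.supported R R (Z : Set X) ∧ ρ k = w j := by
    intro j
    obtain ⟨k, ⟨hk1, hk2⟩, hk⟩ := hw j
    exact ⟨⟨k, hk1⟩, hk2, hk⟩
  choose k' hk' hk'' using h1
  refine ⟨Finset.univ.biUnion fun j => (τ (k' j)).support, ?_⟩
  intro k hk
  have hks : (k : X →₀ R) ∈ Finsupp.supported R R (Z : Set X) := by
    rw [Finsupp.mem_supported]
    intro x hx
    exact hk x (by simpa using hx)
  have h2 := hall (ρ k) ⟨1, one_mem _, by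
    rw [one_smul]; exact ⟨k, ⟨k.2, hks⟩, rfl⟩⟩
  have h3 : r • k = ∑ j, (ρ k j) • k' j := by
    apply Subtype.ext
    have hm1 : ((r • k : K) : X →₀ R) ∈ Finsupp.supported R R (Z : Set X) :=
      Submodule.smul_mem _ _ hks
    have hm2 : ((∑ j, (ρ k j) • k' j : K) : X →₀ R) ∈ Finsupp.supported R R (Z : Set X) := by
      rw [Submodule.coe_sum]
      exact Submodule.sum_mem _ fun j _ => Submodule.smul_mem _ _ (hk' j)
    ext x
    by_cases hx : x ∈ Z
    · have h4 := congrFun h2 ⟨x, hx⟩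
      have h5 : ρ ((r • k : K) : X →₀ R) = ρ ((∑ j, (ρ k j) • k' j : K) : X →₀ R) := by
        rw [Submodule.coe_sum, Submodule.coe_smul, map_smul, map_sum, h2]
        refine Finset.sum_congr rfl fun j _ => ?_
        rw [Submodule.coe_smul, map_smul, hk'']
      exact congrFun h5 ⟨x, hx⟩
    · rw [(Finsupp.mem_supported' R _).1 hm1 x (by simpa using hx),
        (Finsupp.mem_supported' R _).1 hm2 x (by simpa using hx)]
  have h4 := congrArg τ h3
  rw [map_smul, map_sum] at h4
  intro y hy
  by_contra hcon
  simp only [Finset.mem_biUnion, Finset.mem_univ, true_and, not_exists, Finsupp.mem_support_iff,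
    not_not] at hcon hy
  have h5 := DFunLike.congr_fun h4 y
  rw [Finsupp.finsetSum_apply, Finset.sum_eq_zero] at h5
  · rw [Finsupp.smul_apply, smul_eq_mul] at h5
    exact hy ((mem_nonZeroDivisors_iff.1 hr).1 _ h5)
  · intro j _
    rw [map_smul, Finsupp.smul_apply, hcon j, smul_zero]


theorem lattice_trick {R : Type u} [CommRing R] (h : IsSemisimpleRing (FractionRing R))
    {ι : Type*} [Finite ι] (W : Submodule R (ι → R)) :
    ∃ r ∈ nonZeroDivisors R, ∀ v : ι → R, (∃ s ∈ nonZeroDivisors R, s • v ∈ W) →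
      ∀ w ∈ W, (∀ j, ∃ a, w j - v j = r * a) → v ∈ W := by
  have := Fintype.ofFinite ι
  obtain ⟨r, hr, w', hw', hall⟩ := lattice_approx h W
  refine ⟨r, hr, ?_⟩
  intro v hv w hw hdvd
  obtain ⟨s, hs, hsv⟩ := hv
  choose u hu using hdvd
  have h1 : r • u = w - v := by
    funext j
    simp [hu j]
  have h2 : r • u ∈ W := by
    rw [hall u ⟨s * r, mul_mem hs hr, ?_⟩]
    · exact W.sum_mem fun j _ => W.smul_mem _ (hw' j)
    · rw [mul_smul, h1, smul_sub]
      exact W.sub_mem (W.smul_mem _ hw) hsv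
  have h3 : v = w - r • u := by rw [h1]; abel
  rw [h3]
  exact W.sub_mem hw h2

theorem quot_isTorsion {R : Type u} [CommRing R] (r : R) (hr : r ∈ nonZeroDivisors R) :
    Module.IsTorsion R (R ⧸ Ideal.span {r}) := by
  intro x
  obtain ⟨x, rfl⟩ := Ideal.Quotient.mk_surjective x
  refine ⟨⟨r, hr⟩, ?_⟩
  change Ideal.Quotient.mk _ (r * x) = 0
  rw [Ideal.Quotient.eq_zero_iff_mem]
  exact Ideal.mul_mem_right _ _ (Ideal.mem_span_singleton_self r)

/-- the direct sum of `R / r i`, inside the product -/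
def sumQuot {R : Type u} [CommRing R] (r : ℕ → R) :
    Submodule R (∀ i, R ⧸ Ideal.span {r i}) where
  carrier := {f | ∃ n, ∀ i, n ≤ i → f i = 0}
  zero_mem' := ⟨0, fun _ _ => rfl⟩
  add_mem' := by
    rintro f g ⟨n, hn⟩ ⟨m, hm⟩
    refine ⟨max n m, fun i hi => ?_⟩
    rw [Pi.add_apply, hn i (le_trans (le_max_left _ _) hi),
      hm i (le_trans (le_max_right _ _) hi), add_zero]
  smul_mem' := by
    rintro c f ⟨n, hn⟩
    refine ⟨n, fun i hi => ?_⟩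
    rw [Pi.smul_apply, hn i hi, smul_zero]

theorem sumQuot_isTorsion {R : Type u} [CommRing R] (r : ℕ → R)
    (hr : ∀ i, r i ∈ nonZeroDivisors R) : Module.IsTorsion R (sumQuot r) := by
  rintro ⟨f, n, hn⟩
  refine ⟨⟨∏ i ∈ Finset.range n, r i, prod_mem fun i _ => hr i⟩, ?_⟩
  apply Subtype.ext
  funext i
  change (∏ i ∈ Finset.range n, r i) • f i = 0
  by_cases hi : n ≤ i
  · rw [hn i hi, smul_zero]
  · have hi' : i ∈ Finset.range n := by simpa using hi
    rw [← Finset.prod_erase_mul _ _ hi', mul_smul]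
    have : r i • f i = 0 := by
      obtain ⟨x, hx⟩ := Ideal.Quotient.mk_surjective (f i)
      rw [← hx]
      change Ideal.Quotient.mk _ (r i * x) = 0
      rw [Ideal.Quotient.eq_zero_iff_mem]
      exact Ideal.mul_mem_right _ _ (Ideal.mem_span_singleton_self _)
    rw [this, smul_zero]

theorem mk_eq_imp {R : Type u} [CommRing R] (r a b : R)
    (h : (Ideal.span {r}).mkQ a = (Ideal.span {r}).mkQ b) : ∃ c, a - b = r * c := by
  have : a - b ∈ Ideal.span {r} := (Submodule.Quotient.eq _).1 h
  obtain ⟨c, hc⟩ := Ideal.mem_span_singleton'.1 this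
  exact ⟨c, by rw [← hc, mul_comm]⟩

theorem count_stab {R : Type u} [CommRing R] (h : IsSemisimpleRing (FractionRing R))
    {X : Type u} (K : Submodule R (X →₀ R)) (hK : BaerPair K) (y : ℕ → K)
    (hy : ⊤ ≤ Submodule.span R (Set.range y)) (Z : Finset X) :
    ∃ n, ∀ m, n ≤ m → ∀ g : (X →₀ R) →ₗ[R] R, (∀ i < n, g (y i) = 0) →
      ∃ g' : (X →₀ R) →ₗ[R] R, (∀ i < m, g' (y i) = 0) ∧
        ∀ z ∈ Z, g' (Finsupp.single z 1) = g (Finsupp.single z 1) := by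
  classical
  let ρ : ((X →₀ R) →ₗ[R] R) →ₗ[R] (Z → R) :=
    LinearMap.pi fun z => LinearMap.applyₗ (Finsupp.single z.1 1)
  have hρ : ∀ g z, ρ g z = g (Finsupp.single z.1 1) := fun _ _ => rfl
  let Kill : ℕ → Submodule R ((X →₀ R) →ₗ[R] R) := fun n =>
    { carrier := {g | ∀ i < n, g (y i) = 0}
      zero_mem' := fun _ _ => rfl
      add_mem' := by
        intro a b ha hb i hi
        rw [LinearMap.add_apply, ha i hi, hb i hi, add_zero]
      smul_mem' := by
        intro c a ha i hi
        rw [LinearMap.smul_apply, ha i hi, smul_zero] }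
  let U : ℕ → Submodule R (Z → R) := fun n => (Kill n).map ρ
  have hU : Antitone U := by
    intro a b hab
    refine Submodule.map_mono ?_
    intro g hg i hi
    exact hg i (lt_of_lt_of_le hi hab)
  obtain ⟨n0, hn0⟩ := lattice_stabilize h U hU
  by_contra hcon
  push Not at hcon
  have hcon' : ∀ n, ∃ m, n < m ∧ ∃ g : (X →₀ R) →ₗ[R] R, g ∈ Kill n ∧ ρ g ∉ U m := by
    intro n
    obtain ⟨m, hm, g, hg, hg'⟩ := hcon n
    refine ⟨m + 1, by omega, g, hg, ?_⟩
    rintro ⟨g', hg1, hg2⟩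
    obtain ⟨z, hz, hz'⟩ := hg' g' (fun i hi => hg1 i (by omega))
    exact hz' (congrFun hg2 ⟨z, hz⟩)
  choose nx hnx H hH1 hH2 using hcon'
  let s : ℕ → ℕ := fun i => Nat.rec n0 (fun _ p => nx p) i
  have hs1 : ∀ i, s (i + 1) = nx (s i) := fun i => rfl
  have hs : ∀ i, n0 ≤ s i ∧ i ≤ s i := by
    intro i
    induction i with
    | zero => exact ⟨le_rfl, Nat.zero_le _⟩
    | succ i ih =>
      have := hnx (s i)
      rw [hs1]
      omega
  -- lattice
  let ev : ∀ i, ((X →₀ R) →ₗ[R] R) →ₗ[R] (Z ⊕ Fin (s (i + 1)) → R) := fun i =>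
    LinearMap.pi fun z => LinearMap.applyₗ (Sum.elim (fun z : Z => Finsupp.single z.1 1)
      (fun j => (y j : X →₀ R)) z)
  have hev1 : ∀ i g z, ev i g (Sum.inl z) = g (Finsupp.single z.1 1) := fun _ _ _ => rfl
  have hev2 : ∀ i g j, ev i g (Sum.inr j) = g (y j) := fun _ _ _ => rfl
  have htr := fun i => lattice_trick h (LinearMap.range (ev i))
  choose r hr hr' using htr
  -- the map
  let e0 : K →ₗ[R] (∀ i, R ⧸ Ideal.span {r i}) :=
    LinearMap.pi fun i => (Ideal.span {r i}).mkQ ∘ₗ H (s i) ∘ₗ K.subtype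
  have he0 : ∀ k i, e0 k i = (Ideal.span {r i}).mkQ (H (s i) k) := fun _ _ => rfl
  have hmem : ∀ k, e0 k ∈ sumQuot r := by
    have : Submodule.span R (Set.range y) ≤ (sumQuot r).comap e0 := by
      rw [Submodule.span_le]
      rintro _ ⟨j, rfl⟩
      refine ⟨j + 1, fun i hi => ?_⟩
      rw [he0, hH1 (s i) j (by have := hs i; omega), map_zero]
    intro k
    exact this (hy trivial)
  obtain ⟨g, hg⟩ := hK (sumQuot r) (sumQuot_isTorsion r hr) (e0.codRestrict _ hmem)
  have hfin : ∃ i, ∀ z ∈ Z, (g (Finsupp.single z 1)).1 i = 0 := by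
    have : ∀ z : X, ∃ n, ∀ i, n ≤ i → (g (Finsupp.single z 1)).1 i = 0 := fun z => (g _).2
    choose n hn using this
    exact ⟨Z.sup n, fun z hz => hn z _ (Finset.le_sup hz)⟩
  obtain ⟨i, hi⟩ := hfin
  let gi : (X →₀ R) →ₗ[R] R ⧸ Ideal.span {r i} :=
    LinearMap.proj i ∘ₗ (sumQuot r).subtype ∘ₗ g
  obtain ⟨l, hl⟩ := Module.projective_lifting_property (Ideal.span {r i}).mkQ
    ((Ideal.span {r i}).mkQ ∘ₗ H (s i) - gi) (Submodule.mkQ_surjective _)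
  let v : Z ⊕ Fin (s (i + 1)) → R := Sum.elim (ρ (H (s i))) 0
  have hvmem : v ∈ LinearMap.range (ev i) := by
    apply hr' i v _ (ev i l) ⟨l, rfl⟩
    · rintro (z | j)
      · apply mk_eq_imp
        have h1 := LinearMap.congr_fun hl (Finsupp.single z.1 1)
        simp only [LinearMap.comp_apply, LinearMap.sub_apply] at h1
        rw [hev1, h1]
        have h2 : gi (Finsupp.single z.1 1) = 0 := hi z.1 z.2
        rw [h2, sub_zero]
        rfl
      · apply mk_eq_imp
        have h1 := LinearMap.congr_fun hl (y j)
        simp only [LinearMap.comp_apply, LinearMap.sub_apply] at h1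
        rw [hev2, h1]
        have h2 : gi (y j) = (Ideal.span {r i}).mkQ (H (s i) (y j)) := by
          change (g (y j)).1 i = _
          rw [hg]
          rfl
        rw [h2, sub_self]
        simp [v]
    · have h1 : ρ (H (s i)) ∈ U n0 := hU (hs i).1 ⟨_, hH1 (s i), rfl⟩
      obtain ⟨c, hc, g1, hg1, hg2⟩ := hn0 (s (i + 1)) (hs (i + 1)).1 _ h1
      refine ⟨c, hc, g1, ?_⟩
      funext q
      rcases q with z | j
      · exact congrFun hg2 z
      · rw [hev2, hg1 j j.2]
        simp [v]
  obtain ⟨g', hg'⟩ := hvmem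
  apply hH2 (s i)
  refine ⟨g', ?_, ?_⟩
  · intro j hj
    exact congrFun hg' (Sum.inr ⟨j, hj⟩)
  · funext z
    exact congrFun hg' (Sum.inl z)

theorem count_ext {R : Type u} [CommRing R] (h : IsSemisimpleRing (FractionRing R))
    {X : Type u} (K : Submodule R (X →₀ R)) (hK : BaerPair K) (y : ℕ → K)
    (e : K →ₗ[R] R) (n : ℕ) :
    ∃ g : (X →₀ R) →ₗ[R] R, ∀ i < n, g (y i) = e (y i) := by
  classical
  let ev : ((X →₀ R) →ₗ[R] R) →ₗ[R] (Fin n → R) :=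
    LinearMap.pi fun j => LinearMap.applyₗ (y j : X →₀ R)
  have hev : ∀ g j, ev g j = g (y j) := fun _ _ => rfl
  obtain ⟨r, hr, hall⟩ := lattice_trick h (LinearMap.range ev)
  let v : Fin n → R := fun j => e (y j)
  obtain ⟨g, hg⟩ := hK _ (quot_isTorsion r hr) ((Ideal.span {r}).mkQ ∘ₗ e)
  obtain ⟨l, hl⟩ := Module.projective_lifting_property (Ideal.span {r}).mkQ g
    (Submodule.mkQ_surjective _)
  have hv : v ∈ LinearMap.range ev := by
    apply hall v _ (ev l) ⟨l, rfl⟩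
    · intro j
      apply mk_eq_imp
      have h1 := LinearMap.congr_fun hl (y j)
      rw [hg] at h1
      exact h1
    · have hbij : ∀ s ∈ nonZeroDivisors R,
          Function.Bijective (fun x : FractionRing R => s • x) := by
        intro s hs
        have hu : IsUnit (algebraMap R (FractionRing R) s) :=
          IsLocalization.map_units (FractionRing R) (⟨s, hs⟩ : nonZeroDivisors R)
        have : (fun x : FractionRing R => s • x) =
          fun x => algebraMap R (FractionRing R) s * x := by
          funext x; rw [Algebra.smul_def]
        rw [this]
        exact IsUnit.isUnit_iff_mulLeft_bijective.1 hu
      obtain ⟨g', hg'⟩ := extPair_of_bijective h K (FractionRing R) hbij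
        (Algebra.linearMap R (FractionRing R) ∘ₗ e)
      let A : Finset X := (Finset.range n).biUnion fun i => (y i : X →₀ R).support
      obtain ⟨s, hs⟩ := IsLocalization.exist_integer_multiples (nonZeroDivisors R) A
        (fun x => g' (Finsupp.single x 1))
      have : ∀ x, ∃ a : R, x ∈ A → algebraMap R (FractionRing R) a =
          (s : R) • g' (Finsupp.single x 1) := by
        intro x
        by_cases hx : x ∈ A
        · obtain ⟨a, ha⟩ := hs x hx
          exact ⟨a, fun _ => ha⟩
        · exact ⟨0, fun h => absurd h hx⟩
      choose a ha using this
      refine ⟨s, s.2, Finsupp.linearCombination R a, ?_⟩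
      funext j
      apply IsFractionRing.injective R (FractionRing R)
      rw [hev]
      have h1 : algebraMap R (FractionRing R) (((s : R) • v) j) = (s : R) • g' (y j) := by
        rw [hg']
        simp [v, Algebra.smul_def]
      rw [h1]
      have h2 : (y j : X →₀ R) = (y j : X →₀ R).sum fun x c => c • Finsupp.single x (1 : R) := by
        simp
      conv_rhs => rw [h2]
      rw [Finsupp.linearCombination_apply, Finsupp.sum, Finsupp.sum, map_sum, map_sum,
        Finset.smul_sum]
      refine Finset.sum_congr rfl fun x hx => ?_
      have hxA : x ∈ A := Finset.mem_biUnion.2 ⟨j, by simp, hx⟩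
      rw [smul_eq_mul, map_mul, ha x hxA, map_smul, smul_comm, Algebra.smul_def, Algebra.smul_def]
  obtain ⟨g1, hg1⟩ := hv
  exact ⟨g1, fun i hi => congrFun hg1 ⟨i, hi⟩⟩

theorem count_stab_vec {R : Type u} [CommRing R] (h : IsSemisimpleRing (FractionRing R))
    {X Y : Type u} (K : Submodule R (X →₀ R)) (hK : BaerPair K) (y : ℕ → K)
    (hy : ⊤ ≤ Submodule.span R (Set.range y)) (Z : Finset X) :
    ∃ n, ∀ m, n ≤ m → ∀ g : (X →₀ R) →ₗ[R] (Y →₀ R), (∀ i < n, g (y i) = 0) →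
      ∃ g' : (X →₀ R) →ₗ[R] (Y →₀ R), (∀ i < m, g' (y i) = 0) ∧
        ∀ z ∈ Z, g' (Finsupp.single z 1) = g (Finsupp.single z 1) := by
  classical
  obtain ⟨n, hn⟩ := count_stab h K hK y hy Z
  refine ⟨n, fun m hm g hg => ?_⟩
  have h1 : ∀ b : Y, ∃ g' : (X →₀ R) →ₗ[R] R, (∀ i < m, g' (y i) = 0) ∧
        ∀ z ∈ Z, g' (Finsupp.single z 1) = g (Finsupp.single z 1) b := by
    intro b
    refine hn m hm (Finsupp.lapply b ∘ₗ g) ?_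
    intro i hi
    simp [hg i hi]
  choose g' hg1 hg2 using h1
  let A : Finset Y := Z.biUnion fun z => (g (Finsupp.single z 1)).support
  refine ⟨∑ b ∈ A, Finsupp.lsingle b ∘ₗ g' b, ?_, ?_⟩
  · intro i hi
    simp only [LinearMap.sum_apply, LinearMap.comp_apply]
    refine Finset.sum_eq_zero fun b _ => ?_
    rw [hg1 b i hi, map_zero]
  · intro z hz
    ext b
    simp only [LinearMap.sum_apply, LinearMap.comp_apply, Finsupp.finsetSum_apply,
      Finsupp.lsingle_apply, Finsupp.single_apply, hg2 _ z hz, Finset.sum_ite_eq']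
    split_ifs with hb
    · rfl
    · by_contra hne
      exact hb (Finset.mem_biUnion.2 ⟨z, hz, Finsupp.mem_support_iff.2 (Ne.symm hne)⟩)

theorem count_ext_vec {R : Type u} [CommRing R] (h : IsSemisimpleRing (FractionRing R))
    {X Y : Type u} (K : Submodule R (X →₀ R)) (hK : BaerPair K) (y : ℕ → K)
    (e : K →ₗ[R] (Y →₀ R)) (n : ℕ) :
    ∃ g : (X →₀ R) →ₗ[R] (Y →₀ R), ∀ i < n, g (y i) = e (y i) := by
  classical
  have h1 : ∀ b : Y, ∃ g' : (X →₀ R) →ₗ[R] R, ∀ i < n, g' (y i) = e (y i) b := by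
    intro b
    exact count_ext h K hK y (Finsupp.lapply b ∘ₗ e) n
  choose g' hg' using h1
  let A : Finset Y := (Finset.range n).biUnion fun i => (e (y i)).support
  refine ⟨∑ b ∈ A, Finsupp.lsingle b ∘ₗ g' b, ?_⟩
  intro i hi
  ext b
  simp only [LinearMap.sum_apply, LinearMap.comp_apply, Finsupp.finsetSum_apply,
      Finsupp.lsingle_apply, Finsupp.single_apply, hg' _ i hi, Finset.sum_ite_eq']
  split_ifs with hb
  · rfl
  · by_contra hne
    exact hb (Finset.mem_biUnion.2 ⟨i, Finset.mem_range.2 hi,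
      Finsupp.mem_support_iff.2 (Ne.symm hne)⟩)

/-- the linear map from a free module given on the basis agrees with another map on
an element as soon as they agree on the support -/
theorem finsupp_agree {R : Type u} [CommRing R] {X N : Type u} [AddCommMonoid N] [Module R N]
    (f g : (X →₀ R) →ₗ[R] N) (k : X →₀ R)
    (hk : ∀ x, k x ≠ 0 → f (Finsupp.single x 1) = g (Finsupp.single x 1)) : f k = g k := by
  have h2 : k = k.sum fun x c => c • Finsupp.single x (1 : R) := by simp
  rw [h2, Finsupp.sum, map_sum, map_sum]
  refine Finset.sum_congr rfl fun x hx => ?_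
  rw [map_smul, map_smul, hk x (Finsupp.mem_support_iff.1 hx)]

/-- existence of a retraction onto a submodule -/
def HasRetr {R : Type u} [CommRing R] {F : Type u} [AddCommGroup F] [Module R F]
    (K : Submodule R F) : Prop := ∃ t : F →ₗ[R] K, ∀ k : K, t k = k

theorem count_retr {R : Type u} [CommRing R] (h : IsSemisimpleRing (FractionRing R))
    {X : Type u} [Countable X] (K : Submodule R (X →₀ R)) (hK : BaerPair K) : HasRetr K := by
  classical
  obtain ⟨τ, hτ⟩ := exists_tau h K hK
  obtain ⟨ν, hν⟩ := Countable.exists_injective_nat X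
  let Z : ℕ → Finset X := fun j => (Finset.range j).preimage ν hν.injOn
  have hZ : ∀ j x, x ∈ Z j ↔ ν x < j := by
    intro j x
    simp [Z]
  have hbd : ∀ k : X →₀ R, ∃ j, ∀ x, k x ≠ 0 → x ∈ Z j := by
    intro k
    refine ⟨k.support.sup ν + 1, fun x hx => ?_⟩
    rw [hZ]
    have := Finset.le_sup (f := ν) (Finsupp.mem_support_iff.2 hx)
    omega
  -- countable generation
  have hA := fun j => finite_support h K τ (Z j)
  choose A hA using hA
  have hcnt : (insert (0 : K) (⋃ j, (A j : Set K))).Countable :=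
    (Set.countable_iUnion fun j => (A j).countable_toSet).insert _
  obtain ⟨y, hy⟩ := hcnt.exists_eq_range ⟨0, Set.mem_insert _ _⟩
  have hspan : ⊤ ≤ Submodule.span R (Set.range y) := by
    rw [← hy]
    intro k _
    obtain ⟨j, hj⟩ := hbd k
    have h1 := hA j k hj
    rw [← hτ k, Finsupp.linearCombination_apply]
    refine Submodule.sum_mem _ fun z hz => Submodule.smul_mem _ _ (Submodule.subset_span ?_)
    exact Set.mem_insert_of_mem _ (Set.mem_iUnion.2 ⟨j, h1 hz⟩)
  have hN := fun j => count_stab_vec (Y := K) h K hK y hspan (Z j)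
  choose N hN using hN
  let n : ℕ → ℕ := fun j => N j + j
  let P : ℕ → ((X →₀ R) →ₗ[R] (K →₀ R)) → Prop := fun j g => ∀ i < n j, g (y i) = τ (y i)
  have hstep : ∀ j g, P j g → ∃ g', P (j + 1) g' ∧
      ∀ z ∈ Z j, g' (Finsupp.single z 1) = g (Finsupp.single z 1) := by
    intro j g hg
    obtain ⟨gt, hgt⟩ := count_ext_vec h K hK y τ (n j + n (j + 1))
    obtain ⟨g', hg1, hg2⟩ := hN j (n j + n (j + 1)) (by simp only [n]; omega) (g - gt) (by
      intro i hi
      have hi' : i < n j := by simp only [n]; omega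
      rw [LinearMap.sub_apply, hg i hi', hgt i (by omega), sub_self])
    refine ⟨gt + g', ?_, ?_⟩
    · intro i hi
      rw [LinearMap.add_apply, hgt i (by omega), hg1 i (by omega), add_zero]
    · intro z hz
      rw [LinearMap.add_apply, hg2 z hz, LinearMap.sub_apply]
      abel
  have hstep' : ∀ j (g : {g // P j g}), ∃ g' : {g // P (j + 1) g},
      ∀ z ∈ Z j, g'.1 (Finsupp.single z 1) = g.1 (Finsupp.single z 1) := by
    intro j g
    obtain ⟨g', h1, h2⟩ := hstep j g.1 g.2
    exact ⟨⟨g', h1⟩, h2⟩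
  choose nx hnx using hstep'
  obtain ⟨g0, hg0⟩ := count_ext_vec h K hK y τ (n 0)
  let G : ∀ j, {g // P j g} := fun j => Nat.rec ⟨g0, hg0⟩ (fun j g => nx j g) j
  have hG : ∀ j, ∀ z ∈ Z j, (G (j + 1)).1 (Finsupp.single z 1) = (G j).1 (Finsupp.single z 1) :=
    fun j => hnx j (G j)
  have hG' : ∀ x j, ν x + 1 ≤ j →
      (G j).1 (Finsupp.single x 1) = (G (ν x + 1)).1 (Finsupp.single x 1) := by
    intro x j hj
    induction j, hj using Nat.le_induction with
    | base => rfl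
    | succ j hj ih => rw [hG j x ((hZ _ _).2 (by omega)), ih]
  let g : (X →₀ R) →ₗ[R] (K →₀ R) := Finsupp.linearCombination R
    fun x => (G (ν x + 1)).1 (Finsupp.single x 1)
  have hgx : ∀ x, g (Finsupp.single x 1) = (G (ν x + 1)).1 (Finsupp.single x 1) := by
    intro x
    simp [g]
  have hgy : ∀ i, g (y i) = τ (y i) := by
    intro i
    obtain ⟨j, hj⟩ := hbd (y i)
    have h1 : g (y i) = (G (j + i + 1)).1 (y i) := by
      apply finsupp_agree
      intro x hx
      have h2 := (hZ _ _).1 (hj x hx)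
      rw [hgx, hG' x (j + i + 1) (by omega)]
    rw [h1]
    exact (G (j + i + 1)).2 i (by simp only [n]; omega)
  have hgk : ∀ k : K, g k = τ k := by
    have : Submodule.span R (Set.range y) ≤ LinearMap.eqLocus (g ∘ₗ K.subtype) τ := by
      rw [Submodule.span_le]
      rintro _ ⟨i, rfl⟩
      exact hgy i
    intro k
    exact this (hspan trivial)
  refine ⟨Finsupp.linearCombination R (id : K → K) ∘ₗ g, fun k => ?_⟩
  rw [LinearMap.comp_apply, hgk, hτ]


/-- support contained in a set -/
def SuppIn {R : Type u} [CommRing R] {X : Type u} (k : X →₀ R) (Z : Set X) : Prop :=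
  ∀ x, k x ≠ 0 → x ∈ Z

theorem SuppIn.mono {R : Type u} [CommRing R] {X : Type u} {k : X →₀ R} {Z Z' : Set X}
    (h : SuppIn k Z) (hZ : Z ⊆ Z') : SuppIn k Z' := fun x hx => hZ (h x hx)

def TClosed {R : Type u} [CommRing R] {X : Type u} {K : Submodule R (X →₀ R)}
    (τ : K →ₗ[R] (K →₀ R)) (Z : Set X) : Prop :=
  ∀ k : K, SuppIn (k : X →₀ R) Z → ∀ y : K, τ k y ≠ 0 → SuppIn (y : X →₀ R) Z

def RelExt {R : Type u} [CommRing R] {X : Type u} (K : Submodule R (X →₀ R))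
    (Z Z' : Set X) (N : Type u) [AddCommGroup N] [Module R N] : Prop :=
  ∀ e : K →ₗ[R] N, (∀ k : K, SuppIn (k : X →₀ R) Z → e k = 0) →
    ∃ g : (X →₀ R) →ₗ[R] N, (∀ z ∈ Z, g (Finsupp.single z 1) = 0) ∧
      ∀ k : K, SuppIn (k : X →₀ R) Z' → g k = e k

def RelBaer {R : Type u} [CommRing R] {X : Type u} (K : Submodule R (X →₀ R))
    (Z Z' : Set X) : Prop :=
  ∀ (T : Type u) [AddCommGroup T] [Module R T], Module.IsTorsion R T → RelExt K Z Z' T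

theorem RelBaer.mono {R : Type u} [CommRing R] {X : Type u} {K : Submodule R (X →₀ R)}
    {Z Z' Z'' : Set X} (h : RelBaer K Z Z'') (hZ : Z' ⊆ Z'') : RelBaer K Z Z' := by
  intro T _ _ hT e he
  obtain ⟨g, hg1, hg2⟩ := h T hT e he
  exact ⟨g, hg1, fun k hk => hg2 k (hk.mono hZ)⟩

def Good {R : Type u} [CommRing R] {X : Type u} (K : Submodule R (X →₀ R))
    (Z Z' : Set X) : Prop := RelExt K Z Z' K

/-- elements of `K` supported in `Z` -/
def KS {R : Type u} [CommRing R] {X : Type u} (K : Submodule R (X →₀ R)) (Z : Set X) :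
    Submodule R K where
  carrier := {k | SuppIn (k : X →₀ R) Z}
  zero_mem' := fun x hx => absurd rfl hx
  add_mem' := by
    intro a b ha hb x hx
    by_contra hxZ
    have h1 : (a : X →₀ R) x = 0 := by
      by_contra h; exact hxZ (ha x h)
    have h2 : (b : X →₀ R) x = 0 := by
      by_contra h; exact hxZ (hb x h)
    apply hx
    rw [Submodule.coe_add, Finsupp.add_apply, h1, h2, add_zero]
  smul_mem' := by
    intro c a ha x hx
    apply ha x
    intro h0
    apply hx
    rw [Submodule.coe_smul, Finsupp.smul_apply, h0, smul_zero]

theorem mem_KS {R : Type u} [CommRing R] {X : Type u} {K : Submodule R (X →₀ R)} {Z : Set X}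
    (k : K) : k ∈ KS K Z ↔ SuppIn (k : X →₀ R) Z := Iff.rfl

theorem ext_from_closed {R : Type u} [CommRing R] {X : Type u} {K : Submodule R (X →₀ R)}
    (τ : K →ₗ[R] (K →₀ R)) (hτ : ∀ k, Finsupp.linearCombination R (id : K → K) (τ k) = k)
    {Z : Set X} (hZ : TClosed τ Z) {N : Type u} [AddCommGroup N] [Module R N]
    (e : KS K Z →ₗ[R] N) : ∃ e' : K →ₗ[R] N, ∀ k : KS K Z, e' k = e k := by
  classical
  let E : K → N := fun y => if h : y ∈ KS K Z then e ⟨y, h⟩ else 0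
  refine ⟨Finsupp.linearCombination R E ∘ₗ τ, ?_⟩
  intro k
  have h1 : ∀ y ∈ (τ k).support, y ∈ KS K Z := fun y hy =>
    hZ k k.2 y (Finsupp.mem_support_iff.1 hy)
  have h2 : k = ∑ y ∈ (τ k).support.attach, (τ k y.1) • (⟨y.1, h1 y.1 y.2⟩ : KS K Z) := by
    apply Subtype.ext
    rw [Submodule.coe_sum]
    conv_lhs => rw [← hτ k, Finsupp.linearCombination_apply, Finsupp.sum,
      ← Finset.sum_attach]
    rfl
  rw [LinearMap.comp_apply, Finsupp.linearCombination_apply, Finsupp.sum, ← Finset.sum_attach]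
  conv_rhs => rw [h2]
  rw [map_sum]
  refine Finset.sum_congr rfl fun y _ => ?_
  rw [map_smul]
  simp only [E]
  rw [dif_pos (h1 y.1 y.2)]

theorem transfer_fac {R : Type u} [CommRing R] {X : Type u} {Z Z' : Set X}
    {N : Type u} [AddCommGroup N] [Module R N] (g : (X →₀ R) →ₗ[R] N)
    (hg : ∀ z ∈ Z, g (Finsupp.single z 1) = 0) (k : X →₀ R) (hk : SuppIn k Z') :
    g k = Finsupp.linearCombination R
        (fun x : ↥(Z' \ Z) => g (Finsupp.single x.1 1)) (Finsupp.lsubtypeDomain (R := R) (Z' \ Z) k) := by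
  classical
  have h1 : g k = (Finsupp.linearCombination R
      (fun x : ↥(Z' \ Z) => g (Finsupp.single x.1 1)) ∘ₗ Finsupp.lsubtypeDomain (R := R) (Z' \ Z)) k := by
    apply finsupp_agree
    intro x hx
    rw [LinearMap.comp_apply]
    by_cases hxZ : x ∈ Z
    · have : Finsupp.lsubtypeDomain (R := R) (Z' \ Z) (Finsupp.single x (1 : R)) = 0 := by
        ext z
        change (Finsupp.single x (1 : R)) z.1 = 0
        rw [Finsupp.single_apply, if_neg]
        rintro rfl; exact z.2.2 hxZ
      rw [this, map_zero, hg x hxZ]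
    · have : Finsupp.lsubtypeDomain (R := R) (Z' \ Z) (Finsupp.single x (1 : R))
          = Finsupp.single ⟨x, hk x hx, hxZ⟩ 1 := by
        ext z
        change (Finsupp.single x (1 : R)) z.1 = _
        rw [Finsupp.single_apply, Finsupp.single_apply]
        simp only [Subtype.ext_iff]
      rw [this, Finsupp.linearCombination_single, one_smul]
  exact h1

/-- restriction to the coordinates in the difference set -/
noncomputable def resMap {R : Type u} [CommRing R] {X : Type u} (K : Submodule R (X →₀ R))
    (Z Z' : Set X) : KS K Z' →ₗ[R] (↥(Z' \ Z) →₀ R) :=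
  (Finsupp.lsubtypeDomain (R := R) (M := R) (Z' \ Z)) ∘ₗ K.subtype ∘ₗ (KS K Z').subtype

theorem resMap_apply {R : Type u} [CommRing R] {X : Type u} (K : Submodule R (X →₀ R))
    (Z Z' : Set X) (k : KS K Z') :
    resMap K Z Z' k = Finsupp.lsubtypeDomain (R := R) (M := R) (Z' \ Z) ((k : K) : X →₀ R) := rfl

theorem resMap_apply' {R : Type u} [CommRing R] {X : Type u} (K : Submodule R (X →₀ R))
    (Z Z' : Set X) (k : KS K Z') (x : ↥(Z' \ Z)) :
    resMap K Z Z' k x = ((k : K) : X →₀ R) x.1 := rfl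

theorem transfer_baer {R : Type u} [CommRing R] {X : Type u} {K : Submodule R (X →₀ R)}
    (τ : K →ₗ[R] (K →₀ R)) (hτ : ∀ k, Finsupp.linearCombination R (id : K → K) (τ k) = k)
    {Z Z' : Set X} (hZZ : Z ⊆ Z') (hZ' : TClosed τ Z')
    (hrel : RelBaer K Z Z') : BaerPair (LinearMap.range (resMap K Z Z')) := by
  intro T _ _ hT e
  obtain ⟨e', he'⟩ := ext_from_closed τ hτ hZ' (e ∘ₗ (resMap K Z Z').rangeRestrict)
  obtain ⟨g, hg1, hg2⟩ := hrel T hT e' (by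
    intro k hk
    have h1 := he' ⟨k, hk.mono hZZ⟩
    rw [h1, LinearMap.comp_apply]
    have h2 : (resMap K Z Z').rangeRestrict ⟨k, hk.mono hZZ⟩ = 0 := by
      apply Subtype.ext
      ext x
      change (k : X →₀ R) x.1 = 0
      by_contra hx
      exact x.2.2 (hk _ hx)
    rw [h2, map_zero])
  refine ⟨Finsupp.linearCombination R (fun x : ↥(Z' \ Z) => g (Finsupp.single x.1 1)), ?_⟩
  rintro ⟨_, k, rfl⟩
  have h3 := transfer_fac g hg1 k k.2
  rw [hg2 k k.2, he'] at h3
  exact h3.symm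

theorem exists_desc {R : Type u} [CommRing R] {M N P : Type u} [AddCommMonoid M] [Module R M]
    [AddCommMonoid N] [Module R N] [AddCommMonoid P] [Module R P] (f : M →ₗ[R] N)
    (hf : Function.Surjective f) (e : M →ₗ[R] P) (he : ∀ a b, f a = f b → e a = e b) :
    ∃ e1 : N →ₗ[R] P, ∀ k, e1 (f k) = e k := by
  choose s hs using hf
  refine ⟨{ toFun := fun n => e (s n), map_add' := ?_, map_smul' := ?_ }, ?_⟩
  · intro a b
    rw [← map_add]
    apply he
    rw [map_add, hs, hs, hs]
  · intro c a
    rw [RingHom.id_apply, ← map_smul]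
    apply he
    rw [map_smul, hs, hs]
  · intro k
    apply he
    exact hs _

theorem transfer {R : Type u} [CommRing R] {X : Type u} {K : Submodule R (X →₀ R)}
    (τ : K →ₗ[R] (K →₀ R)) (hτ : ∀ k, Finsupp.linearCombination R (id : K → K) (τ k) = k)
    {Z Z' : Set X} (hZZ : Z ⊆ Z') (hZ' : TClosed τ Z')
    (hrel : RelBaer K Z Z')
    (H : ∀ K' : Submodule R (↥(Z' \ Z) →₀ R), BaerPair K' → HasRetr K') : Good K Z Z' := by
  obtain ⟨t, ht⟩ := H _ (transfer_baer τ hτ hZZ hZ' hrel)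
  intro e he
  obtain ⟨e1, he1⟩ : ∃ e1 : LinearMap.range (resMap K Z Z') →ₗ[R] K,
      ∀ k : KS K Z', e1 ((resMap K Z Z').rangeRestrict k) = e k := by
    refine exists_desc (resMap K Z Z').rangeRestrict
      (LinearMap.surjective_rangeRestrict (resMap K Z Z')) (e ∘ₗ (KS K Z').subtype) ?_
    intro a b hab
    have hab' : resMap K Z Z' a = resMap K Z Z' b := congrArg Subtype.val hab
    change e a = e b
    let d : K := ⟨((a : K) : X →₀ R) - ((b : K) : X →₀ R), K.sub_mem a.1.2 b.1.2⟩
    have hd : (a : K) = (b : K) + d := by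
      apply Subtype.ext
      change ((a : K) : X →₀ R) = ((b : K) : X →₀ R) + (((a : K) : X →₀ R) - ((b : K) : X →₀ R))
      abel
    suffices hs : e d = 0 by rw [hd, map_add, hs, add_zero]
    refine he _ ?_
    intro x hx
    by_contra hxZ
    apply hx
    have h1 : (d : X →₀ R) x = ((a : K) : X →₀ R) x - ((b : K) : X →₀ R) x :=
      rfl
    rw [h1, sub_eq_zero]
    by_cases hxZ' : x ∈ Z'
    · exact DFunLike.congr_fun hab' ⟨x, hxZ', hxZ⟩
    · have h2 : ((a : K) : X →₀ R) x = 0 := by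
        by_contra h; exact hxZ' (a.2 x h)
      have h3 : ((b : K) : X →₀ R) x = 0 := by
        by_contra h; exact hxZ' (b.2 x h)
      rw [h2, h3]
  refine ⟨e1 ∘ₗ t ∘ₗ Finsupp.lsubtypeDomain (R := R) (M := R) (Z' \ Z), ?_, ?_⟩
  · intro z hz
    have : Finsupp.lsubtypeDomain (R := R) (Z' \ Z) (Finsupp.single z (1 : R)) = 0 := by
      ext x
      change (Finsupp.single z (1 : R)) x.1 = 0
      classical
      rw [Finsupp.single_apply, if_neg]
      rintro rfl; exact x.2.2 hz
    rw [LinearMap.comp_apply, LinearMap.comp_apply, this, map_zero, map_zero]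
  · intro k hk
    have h1 := he1 ⟨k, hk⟩
    have h2 := ht ((resMap K Z Z').rangeRestrict ⟨k, hk⟩)
    rw [← h1, ← h2]
    rfl

/-- a finitely supported element supported in a directed union is supported in a member -/
theorem suppIn_of_directed {R : Type u} [CommRing R] {X : Type u} {κ : Type*} (c : Set κ)
    (f : κ → Set X) (hn : c.Nonempty) (hc : ∀ i ∈ c, ∀ j ∈ c, f i ⊆ f j ∨ f j ⊆ f i)
    (k : X →₀ R) (hk : SuppIn k (⋃ i ∈ c, f i)) : ∃ i ∈ c, SuppIn k (f i) := by
  have hd : DirectedOn (fun i j => f i ⊆ f j) c := by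
    intro i hi j hj
    rcases hc i hi j hj with h | h
    · exact ⟨j, hj, h, subset_rfl⟩
    · exact ⟨i, hi, subset_rfl, h⟩
  obtain ⟨i, hi, h⟩ := DirectedOn.exists_mem_subset_of_finset_subset_biUnion hn hd
    (s := k.support) (by
      intro x hx
      exact hk x (Finsupp.mem_support_iff.1 hx))
  exact ⟨i, hi, fun x hx => h (Finsupp.mem_support_iff.2 hx)⟩

theorem tclosed_biUnion {R : Type u} [CommRing R] {X : Type u} {K : Submodule R (X →₀ R)}
    (τ : K →ₗ[R] (K →₀ R)) {κ : Type*} (c : Set κ)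
    (f : κ → Set X) (hc : ∀ i ∈ c, ∀ j ∈ c, f i ⊆ f j ∨ f j ⊆ f i)
    (hcl : ∀ i ∈ c, TClosed τ (f i)) : TClosed τ (⋃ i ∈ c, f i) := by
  intro k hk y hy
  rcases c.eq_empty_or_nonempty with rfl | hn
  · have : k = 0 := by
      apply Subtype.ext
      ext x
      by_contra hx
      simpa using hk x hx
    rw [this, map_zero] at hy
    exact absurd rfl hy
  · obtain ⟨i, hi, h⟩ := suppIn_of_directed c f hn hc _ hk
    exact (hcl i hi k h y hy).mono (Set.subset_biUnion_of_mem hi)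

theorem exists_diff {R : Type u} [CommRing R] {F : Type u} [AddCommGroup F] [Module R F]
    (K : Submodule R F) (t : F →ₗ[R] K) : ∃ e : K →ₗ[R] K, ∀ k : K, e k = k - t k :=
  ⟨LinearMap.id - t ∘ₗ K.subtype, fun _ => rfl⟩

theorem zorn_retr {R : Type u} [CommRing R] {X : Type u} (K : Submodule R (X →₀ R))
    (A : Set (Set X)) (hA : ∀ c ⊆ A, ⋃₀ c ∈ A)
    (hnext : ∀ Z ∈ A, ∀ x, ∃ Z' ∈ A, Z ⊆ Z' ∧ x ∈ Z' ∧ Good K Z Z') : HasRetr K := by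
  classical
  let P : Type u := {p : Set X × ((X →₀ R) →ₗ[R] K) //
    p.1 ∈ A ∧ ∀ k : K, SuppIn (k : X →₀ R) p.1 → p.2 k = k}
  let r : P → P → Prop := fun p q => p.1.1 ⊆ q.1.1 ∧
    ∀ x ∈ p.1.1, p.1.2 (Finsupp.single x 1) = q.1.2 (Finsupp.single x 1)
  have htrans : ∀ {a b c : P}, r a b → r b c → r a c := by
    rintro a b c ⟨h1, h2⟩ ⟨h3, h4⟩
    exact ⟨h1.trans h3, fun x hx => (h2 x hx).trans (h4 x (h1 hx))⟩
  obtain ⟨m, hm⟩ := exists_maximal_of_chains_bounded (r := r) (by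
    intro c hc
    have htot : ∀ p ∈ c, ∀ q ∈ c, r p q ∨ r q p := by
      intro p hp q hq
      by_cases hpq : p = q
      · subst hpq; exact Or.inl ⟨subset_rfl, fun _ _ => rfl⟩
      · exact hc hp hq hpq
    let U : Set X := ⋃ p ∈ c, p.1.1
    have hU : U ∈ A := by
      have : U = ⋃₀ ((fun p : P => p.1.1) '' c) := by
        simp [U, Set.sUnion_image]
      rw [this]
      apply hA
      rintro _ ⟨p, _, rfl⟩
      exact p.2.1
    have hch : ∀ x : X, ∃ v : K, ∀ p ∈ c, x ∈ p.1.1 → v = p.1.2 (Finsupp.single x 1) := by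
      intro x
      by_cases hx : ∃ p ∈ c, x ∈ p.1.1
      · obtain ⟨p, hp, hxp⟩ := hx
        refine ⟨p.1.2 (Finsupp.single x 1), fun q hq hxq => ?_⟩
        rcases htot p hp q hq with h | h
        · exact h.2 x hxp
        · exact (h.2 x hxq).symm
      · exact ⟨0, fun p hp hxp => absurd ⟨p, hp, hxp⟩ hx⟩
    choose v hv using hch
    let t : (X →₀ R) →ₗ[R] K := Finsupp.linearCombination R v
    have ht : ∀ x, t (Finsupp.single x 1) = v x := fun x => by simp [t]
    refine ⟨⟨(U, t), hU, ?_⟩, ?_⟩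
    · intro k hk
      rcases c.eq_empty_or_nonempty with rfl | hn
      · have : k = 0 := by
          apply Subtype.ext
          ext x
          by_contra hx
          simpa [U] using hk x hx
        rw [this]
        simp
      · obtain ⟨p, hp, hkp⟩ := suppIn_of_directed c (fun p : P => p.1.1) hn (by
          intro p hp q hq
          rcases htot p hp q hq with h | h
          · exact Or.inl h.1
          · exact Or.inr h.1) _ hk
        have h1 := p.2.2 k hkp
        refine (finsupp_agree t p.1.2 (k : X →₀ R) ?_).trans h1
        intro x hx
        rw [ht, hv x p hp (hkp x hx)]
    · intro p hp
      refine ⟨Set.subset_biUnion_of_mem (u := fun p : P => p.1.1) hp, ?_⟩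
      intro x hx
      change _ = t _
      rw [ht, hv x p hp hx]) htrans
  have huniv : ∀ x, x ∈ m.1.1 := by
    intro x
    obtain ⟨Z', hZ'A, hsub, hx, hgood⟩ := hnext m.1.1 m.2.1 x
    obtain ⟨e, he⟩ := exists_diff K m.1.2
    obtain ⟨g, hg1, hg2⟩ := hgood e (by
      intro k hk
      have h1 := m.2.2 k hk
      rw [he, h1]
      exact sub_self k)
    let q : P := ⟨(Z', m.1.2 + g), hZ'A, by
      intro k hk
      have h1 := hg2 k hk
      change m.1.2 k + g k = k
      rw [h1, he]
      abel⟩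
    have hmq : r m q := by
      refine ⟨hsub, fun z hz => ?_⟩
      change _ = (m.1.2 + g) _
      rw [LinearMap.add_apply, hg1 z hz, add_zero]
    exact (hm q hmq).1 hx
  exact ⟨m.1.2, fun k => m.2.2 k fun x _ => huniv x⟩

theorem dfinsupp_isTorsion {R : Type u} [CommRing R] {ι : Type u} (T : ι → ModuleCat.{u} R)
    (hT : ∀ i, Module.IsTorsion R (T i)) : Module.IsTorsion R (Π₀ i, T i) := by
  classical
  intro f
  induction f using DFinsupp.induction with
  | h0 => exact ⟨1, smul_zero _⟩
  | ha i b f _ _ ih =>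
    obtain ⟨a, ha⟩ := ih
    obtain ⟨c, hc⟩ := @hT i b
    refine ⟨a * c, ?_⟩
    rw [smul_add, mul_comm, mul_smul c a f, ha, smul_zero, add_zero, mul_comm, mul_smul]
    have : c • (DFinsupp.single i b : Π₀ i, T i) = 0 := by
      ext j
      rw [DFinsupp.smul_apply, DFinsupp.single_apply]
      split_ifs with h
      · subst h; exact hc
      · exact smul_zero _
    rw [this, smul_zero]

theorem lemma_S {R : Type u} [CommRing R] {X : Type u} {K : Submodule R (X →₀ R)}
    (hK : BaerPair K)
    (τ : K →ₗ[R] (K →₀ R)) (hτ : ∀ k, Finsupp.linearCombination R (id : K → K) (τ k) = k)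
    {ι : Type u} [LinearOrder ι] (Z Z' : ι → Set X)
    (hcl : ∀ a, TClosed τ (Z' a)) (hlt : ∀ a b, a < b → Z' a ⊆ Z b) :
    ∃ h : X → Finset ι, ∀ a, (∀ x ∈ Z a, a ∉ h x) → RelBaer K (Z a) (Z' a) := by
  classical
  have hch : ∀ a, ∃ T : ModuleCat.{u} R, Module.IsTorsion R T ∧ ∃ e : K →ₗ[R] T,
      (∀ k : K, SuppIn (k : X →₀ R) (Z a) → e k = 0) ∧
      ((∃ g : (X →₀ R) →ₗ[R] T, (∀ z ∈ Z a, g (Finsupp.single z 1) = 0) ∧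
        ∀ k : K, SuppIn (k : X →₀ R) (Z' a) → g k = e k) → RelBaer K (Z a) (Z' a)) := by
    intro a
    by_cases hR : RelBaer K (Z a) (Z' a)
    · exact ⟨ModuleCat.of R PUnit, fun x => ⟨1, Subsingleton.elim _ _⟩, 0, fun _ _ => rfl,
        fun _ => hR⟩
    · unfold RelBaer RelExt at hR
      push Not at hR
      obtain ⟨T, i1, i2, hT, e, he, hno⟩ := hR
      refine ⟨ModuleCat.of R T, hT, e, he, ?_⟩
      rintro ⟨g, hg1, hg2⟩
      obtain ⟨k, hk, hk'⟩ := hno g hg1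
      exact absurd (hg2 k hk) hk'
  choose T hT e he hbad using hch
  have huniq : ∀ (y : K) a b, SuppIn (y : X →₀ R) (Z' a) → ¬ SuppIn (y : X →₀ R) (Z a) →
      SuppIn (y : X →₀ R) (Z' b) → ¬ SuppIn (y : X →₀ R) (Z b) → a = b := by
    intro y a b h1 h2 h3 h4
    rcases lt_trichotomy a b with h | h | h
    · exact absurd (h1.mono (hlt a b h)) h4
    · exact h
    · exact absurd (h3.mono (hlt b a h)) h2
  have hE : ∀ y : K, ∃ v : Π₀ a, T a, ∀ a, SuppIn (y : X →₀ R) (Z' a) → v a = e a y := by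
    intro y
    by_cases hy : ∃ a, SuppIn (y : X →₀ R) (Z' a) ∧ ¬ SuppIn (y : X →₀ R) (Z a)
    · obtain ⟨a, h1, h2⟩ := hy
      refine ⟨DFinsupp.single a (e a y), fun b hb => ?_⟩
      by_cases hb' : SuppIn (y : X →₀ R) (Z b)
      · rw [he b y hb', DFinsupp.single_apply, dif_neg]
        rintro rfl; exact h2 hb'
      · obtain rfl := huniq y a b h1 h2 hb hb'
        rw [DFinsupp.single_apply, dif_pos rfl]
    · push Not at hy
      refine ⟨0, fun b hb => ?_⟩
      rw [he b y (hy b hb)]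
      rfl
  choose E hE using hE
  let e0 : K →ₗ[R] Π₀ a, T a := Finsupp.linearCombination R E ∘ₗ τ
  have he0 : ∀ (k : K) a, SuppIn (k : X →₀ R) (Z' a) → e0 k a = e a k := by
    intro k a hk
    have h1 : e0 k a = ∑ y ∈ (τ k).support, τ k y • (E y a) := by
      simp only [e0, LinearMap.comp_apply]
      rw [Finsupp.linearCombination_apply, Finsupp.sum, DFinsupp.finsetSum_apply]
      rfl
    rw [h1]
    conv_rhs => rw [← hτ k, Finsupp.linearCombination_apply, Finsupp.sum, map_sum]
    refine Finset.sum_congr rfl fun y hy => ?_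
    rw [hE y a (hcl a k hk y (Finsupp.mem_support_iff.1 hy)), map_smul]
    rfl
  obtain ⟨g, hg⟩ := hK (Π₀ a, T a) (dfinsupp_isTorsion T hT) e0
  refine ⟨fun x => (g (Finsupp.single x 1)).support, ?_⟩
  intro a ha
  apply hbad a
  refine ⟨DFinsupp.lapply a ∘ₗ g, ?_, ?_⟩
  · intro z hz
    have := ha z hz
    rw [DFinsupp.notMem_support_iff] at this
    exact this
  · intro k hk
    change g k a = e a k
    rw [hg, he0 k a hk]


section Combinatorics
open Cardinal Set

theorem card_iUnion_le' {X ι : Type u} {μ : Cardinal.{u}} (hμ : ℵ₀ ≤ μ) (s : ι → Set X)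
    (hι : #ι ≤ μ) (hs : ∀ i, #(s i) ≤ μ) : #(⋃ i, s i : Set X) ≤ μ := by
  calc #(⋃ i, s i : Set X) ≤ #ι * ⨆ i, #(s i) := Cardinal.mk_iUnion_le s
    _ ≤ μ * μ := mul_le_mul' hι (ciSup_le' hs)
    _ = μ := Cardinal.mul_eq_self hμ

theorem card_iUnion_nat_le {X : Type u} {μ : Cardinal.{u}} (hμ : ℵ₀ ≤ μ) (s : ℕ → Set X)
    (hs : ∀ i, #(s i) ≤ μ) : #(⋃ i, s i : Set X) ≤ μ := by
  have h : (⋃ i, s i : Set X) = ⋃ i : ULift.{u} ℕ, s i.down := by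
    ext x; simp
  rw [h]
  exact card_iUnion_le' hμ _ (by simpa using hμ) (fun i => hs _)

theorem card_union_le' {X : Type u} {μ : Cardinal.{u}} (hμ : ℵ₀ ≤ μ) (s t : Set X)
    (hs : #s ≤ μ) (ht : #t ≤ μ) : #(s ∪ t : Set X) ≤ μ :=
  (Cardinal.mk_union_le s t).trans (Cardinal.add_le_of_le hμ hs ht)

theorem card_finset_le' {Y : Type u} {μ : Cardinal.{u}} (hμ : ℵ₀ ≤ μ) (hY : #Y ≤ μ) :
    #(Finset Y) ≤ μ := by
  rcases finite_or_infinite Y with h | h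
  · exact (Cardinal.lt_aleph0_of_finite _).le.trans hμ
  · rwa [Cardinal.mk_finset_of_infinite]

theorem card_finset_coe_le {Y : Type u} {μ : Cardinal.{u}} (hμ : ℵ₀ ≤ μ) (A : Finset Y) :
    #((A : Set Y)) ≤ μ :=
  ((Cardinal.lt_aleph0_iff_set_finite.2 A.finite_toSet).le).trans hμ

/-- abstract closure under a finitary operation on finite sets -/
theorem exists_cl {X : Type u} (φ : Finset X → Finset X) :
    ∃ cl : Set X → Set X, (∀ Z, Z ⊆ cl Z) ∧
      (∀ Z, ∀ A : Finset X, (A : Set X) ⊆ cl Z → (φ A : Set X) ⊆ cl Z) ∧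
      ∀ (Z : Set X) (μ : Cardinal.{u}), ℵ₀ ≤ μ → #Z ≤ μ → #(cl Z) ≤ μ := by
  classical
  let step : Set X → Set X := fun Z => Z ∪ ⋃ A : Finset ↥Z, (φ (A.map (Function.Embedding.subtype _)) : Set X)
  have hstep : ∀ Z, Z ⊆ step Z := fun Z => subset_union_left
  have hmono : ∀ Z, Monotone fun n => step^[n] Z := by
    intro Z
    apply monotone_nat_of_le_succ
    intro n
    simp only [Function.iterate_succ_apply']
    exact hstep _
  refine ⟨fun Z => ⋃ n : ℕ, step^[n] Z, ?_, ?_, ?_⟩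
  · intro Z
    exact subset_iUnion (fun n => step^[n] Z) 0
  · intro Z A hA
    obtain ⟨n, hn⟩ : ∃ n, (A : Set X) ⊆ step^[n] Z :=
      Directed.exists_mem_subset_of_finset_subset_biUnion (hmono Z).directed_le hA
    refine Subset.trans ?_ (subset_iUnion (fun n => step^[n] Z) (n + 1))
    simp only [Function.iterate_succ_apply']
    intro x hx
    right
    refine mem_iUnion.2 ⟨A.subtype (· ∈ step^[n] Z), ?_⟩
    rw [Finset.subtype_map_of_mem (fun x hx => hn hx)]
    exact hx
  · intro Z μ hμ hZ
    apply card_iUnion_nat_le hμ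
    intro n
    induction n with
    | zero => exact hZ
    | succ n ih =>
      simp only [Function.iterate_succ_apply']
      exact card_union_le' hμ _ _ ih (card_iUnion_le' hμ _ (card_finset_le' hμ ih)
        (fun A => card_finset_coe_le hμ _))

theorem exists_closure {R : Type u} [CommRing R] (h : IsSemisimpleRing (FractionRing R))
    {X : Type u} (K : Submodule R (X →₀ R)) (τ : K →ₗ[R] (K →₀ R)) :
    ∃ cl : Set X → Set X, (∀ Z, Z ⊆ cl Z) ∧ (∀ Z, TClosed τ (cl Z)) ∧
      ∀ (Z : Set X) (μ : Cardinal.{u}), ℵ₀ ≤ μ → #Z ≤ μ → #(cl Z) ≤ μ := by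
  classical
  choose A hA using fun Z : Finset X => finite_support h K τ Z
  obtain ⟨cl, h1, h2, h3⟩ := exists_cl (fun Z : Finset X =>
    (A Z).biUnion (fun y : K => (y : X →₀ R).support))
  refine ⟨cl, h1, ?_, h3⟩
  intro Z k hk y hy x hx
  have h4 := h2 Z (k : X →₀ R).support (fun x hx => hk x (Finsupp.mem_support_iff.1 hx))
  apply h4
  simp only [Finset.coe_biUnion, mem_iUnion]
  refine ⟨y, hA _ k (fun x hx => Finsupp.mem_support_iff.2 hx) (Finsupp.mem_support_iff.2 hy), ?_⟩
  exact Finsupp.mem_support_iff.2 hx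

theorem exists_wf_rec {ι : Type u} [LinearOrder ι] [WellFoundedLT ι] {X : Type u}
    (Φ : ι → Set X → Set X) : ∃ W : ι → Set X, ∀ b, W b = Φ b (⋃ i : Iio b, W i) := by
  refine ⟨(wellFounded_lt (α := ι)).fix (fun b IH => Φ b (⋃ i : Iio b, IH i.1 i.2)), ?_⟩
  intro b
  rw [WellFounded.fix_eq]

/-- strict upper bounds of small sets -/
theorem exists_ub {κ : Cardinal.{u}} (hκ : κ.IsRegular) (S : Set κ.ord.ToType) (hS : #S < κ) :
    ∃ b, ∀ s ∈ S, s < b := by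
  by_contra hcon
  push Not at hcon
  have hc : IsCofinal S := fun b => by
    obtain ⟨s, hs, hb⟩ := hcon b
    exact ⟨s, hs, hb⟩
  have := Order.cof_le hc
  rw [Ordinal.cof_toType, hκ.cof_ord] at this
  exact absurd hS (not_lt.2 this)

/-- closed-unbounded type argument -/
theorem exists_club {κ : Cardinal.{u}} (hκ : κ.IsRegular) (hκ0 : ℵ₀ < κ) {X : Type u}
    (W : κ.ord.ToType → Set X) (hW : ∀ a, #(W a) < κ) (hmono : Monotone W)
    (h : X → Finset κ.ord.ToType) (a : κ.ord.ToType) :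
    ∃ b, a < b ∧ ∀ i < b, ∀ x ∈ W i, ∀ c ∈ h x, c < b := by
  classical
  have hf : ∀ a, ∃ b, a < b ∧ ∀ x ∈ W a, ∀ c ∈ h x, c < b := by
    intro a
    have h1 : #(⋃ x : W a, (h x : Set κ.ord.ToType) : Set _) < κ :=
      (card_iUnion_lt_iff_forall_of_isRegular hκ (hW a)).2
        (fun x => (card_finset_coe_le le_rfl _).trans_lt hκ0)
    have h2 : #(({a} ∪ ⋃ x : W a, (h x : Set κ.ord.ToType) : Set _)) < κ :=
      (mk_union_le _ _).trans_lt (add_lt_of_lt hκ.aleph0_le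
        (by simpa using (nat_lt_aleph0 1).trans hκ0) h1)
    obtain ⟨b, hb⟩ := exists_ub hκ _ h2
    refine ⟨b, hb a (Or.inl rfl), fun x hx c hc => hb c (Or.inr ?_)⟩
    exact mem_iUnion.2 ⟨⟨x, hx⟩, hc⟩
  choose f hf1 hf2 using hf
  let s : ℕ → κ.ord.ToType := fun n => f^[n] a
  have hs : ∀ n, s (n+1) = f (s n) := fun n => Function.iterate_succ_apply' f n a
  have hne : ({b | ∀ n, s n < b} : Set κ.ord.ToType).Nonempty := by
    obtain ⟨b, hb⟩ := exists_ub hκ (range s) (by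
      have : (range s).Countable := countable_range s
      exact this.le_aleph0.trans_lt hκ0)
    exact ⟨b, fun n => hb _ ⟨n, rfl⟩⟩
  refine ⟨(wellFounded_lt (α := κ.ord.ToType)).min _ hne, ?_, ?_⟩
  · exact (wellFounded_lt (α := κ.ord.ToType)).min_mem _ hne 0
  · intro i hi x hx c hc
    have hmem : ∀ n, s n < _ := (wellFounded_lt (α := κ.ord.ToType)).min_mem _ hne
    have h3 : ∃ n, i ≤ s n := by
      by_contra hcon
      push Not at hcon
      exact (wellFounded_lt (α := κ.ord.ToType)).not_lt_min
        {b | ∀ n, s n < b} (x := i) hcon hi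
    obtain ⟨n, hn⟩ := h3
    have h4 := hf2 (s n) x (hmono hn hx) c hc
    rw [← hs] at h4
    exact h4.trans (hmem _)

theorem lemma_R {R : Type u} [CommRing R] (h : IsSemisimpleRing (FractionRing R)) {X : Type u}
    {K : Submodule R (X →₀ R)} (hK : BaerPair K)
    (τ : K →ₗ[R] (K →₀ R)) (hτ : ∀ k, Finsupp.linearCombination R (id : K → K) (τ k) = k)
    {κ : Cardinal.{u}} (hκ : κ.IsRegular) (hκ0 : ℵ₀ < κ) (extra : κ.ord.ToType → Set X)
    (hextra : ∀ a, #(extra a) < κ) :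
    ∃ (W : κ.ord.ToType → Set X) (g : X → Finset κ.ord.ToType),
      (∀ a, TClosed τ (W a)) ∧ (∀ a, #(W a) < κ) ∧ (∀ a, extra a ⊆ W a) ∧ Monotone W ∧
      ∀ b, (∀ i < b, ∀ x ∈ W i, ∀ c ∈ g x, c < b) →
        ∀ Z', TClosed τ Z' → (⋃ i : Iio b, W i) ⊆ Z' → #Z' < κ →
          RelBaer K (⋃ i : Iio b, W i) Z' := by
  classical
  obtain ⟨cl, hcl1, hcl2, hcl3⟩ := exists_closure h K τ
  have hclκ : ∀ Z : Set X, #Z < κ → #(cl Z) < κ := fun Z hZ =>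
    (hcl3 Z (max #Z ℵ₀) (le_max_right _ _) (le_max_left _ _)).trans_lt (max_lt hZ hκ0)
  have hbad : ∀ Z : Set X, ∃ Z' : Set X, Z ⊆ Z' ∧ (#Z < κ → #Z' < κ) ∧
      (RelBaer K Z Z' → ∀ Z'', TClosed τ Z'' → Z ⊆ Z'' → #Z'' < κ → RelBaer K Z Z'') := by
    intro Z
    by_cases hex : ∃ Z', TClosed τ Z' ∧ Z ⊆ Z' ∧ #Z' < κ ∧ ¬ RelBaer K Z Z'
    · obtain ⟨Z', h1, h2, h3, h4⟩ := hex
      exact ⟨Z', h2, fun _ => h3, fun h5 => absurd h5 h4⟩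
    · push Not at hex
      exact ⟨Z, subset_rfl, id, fun _ Z'' h1 h2 h3 => hex Z'' h1 h2 h3⟩
  choose bad hb1 hb2 hb3 using hbad
  obtain ⟨W, hW⟩ := exists_wf_rec (fun (b : κ.ord.ToType) U => cl (bad U ∪ extra b))
  have hsub : ∀ b, bad (⋃ i : Iio b, W i) ∪ extra b ⊆ W b := by
    intro b
    conv_rhs => rw [hW b]
    exact hcl1 _
  have hUW : ∀ b, (⋃ i : Iio b, W i) ⊆ W b := fun b =>
    ((hb1 _).trans subset_union_left).trans (hsub b)
  have hmono : Monotone W := by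
    intro a b hab
    rcases hab.eq_or_lt with rfl | hab
    · exact subset_rfl
    · exact (subset_iUnion (fun i : Iio b => W i) ⟨a, hab⟩).trans (hUW b)
  have hclW : ∀ a, TClosed τ (W a) := by
    intro a
    rw [hW a]
    exact hcl2 _
  have hcard : ∀ a, #(W a) < κ := by
    intro a
    induction a using WellFoundedLT.induction with
    | ind a ih =>
      rw [hW a]
      apply hclκ
      apply (mk_union_le _ _).trans_lt
      apply add_lt_of_lt hκ.aleph0_le _ (hextra a)
      apply hb2
      exact (card_iUnion_lt_iff_forall_of_isRegular hκ (mk_Iio_toType_ord_lt a)).2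
        (fun i => ih i.1 i.2)
  obtain ⟨g, hg⟩ := lemma_S hK τ hτ (fun b => ⋃ i : Iio b, W i) W hclW
    (fun a b hab => subset_iUnion (fun i : Iio b => W i) ⟨a, hab⟩)
  refine ⟨W, g, hclW, hcard, fun a => subset_union_right.trans (hsub a), hmono, ?_⟩
  intro b hb Z' h1 h2 h3
  refine hb3 _ ((hg b ?_).mono (subset_union_left.trans (hsub b))) Z' h1 h2 h3
  intro x hx hbx
  obtain ⟨i, hi⟩ := mem_iUnion.1 hx
  exact lt_irrefl _ (hb i.1 i.2 x hi b hbx)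

end Combinatorics


section MainInduction
open Cardinal Set

theorem good_self {R : Type u} [CommRing R] {X : Type u} (K : Submodule R (X →₀ R)) (Z : Set X) :
    Good K Z Z := by
  intro e he
  exact ⟨0, fun _ _ => rfl, fun k hk => (he k hk).symm⟩

theorem regular_case {R : Type u} [CommRing R] (h : IsSemisimpleRing (FractionRing R)) {X : Type u}
    {K : Submodule R (X →₀ R)} (hK : BaerPair K) (hreg : (#X).IsRegular) (h0 : ℵ₀ < #X)
    (IH : ∀ Y : Type u, #Y < #X → ∀ K' : Submodule R (Y →₀ R), BaerPair K' → HasRetr K') :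
    HasRetr K := by
  classical
  obtain ⟨τ, hτ⟩ := exists_tau h K hK
  obtain ⟨e⟩ : Nonempty ((#X).ord.ToType ≃ X) := by
    rw [← Cardinal.eq, Cardinal.mk_toType, Cardinal.card_ord]
  obtain ⟨W, g, hcl, hcard, hex, hmono, hrel⟩ := lemma_R h hK τ hτ hreg h0 (fun a => {e a})
    (fun a => by simpa using (natCast_lt_aleph0 (n := 1)).trans h0)
  have hch : ∀ I : Set (#X).ord.ToType, ∀ i ∈ I, ∀ j ∈ I, W i ⊆ W j ∨ W j ⊆ W i := by
    intro I i _ j _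
    rcases le_total i j with hij | hij
    · exact Or.inl (hmono hij)
    · exact Or.inr (hmono hij)
  let Q : Set (#X).ord.ToType → Prop := fun I => IsLowerSet I ∧ ∀ i ∈ I, ∀ x ∈ W i, ∀ c ∈ g x, c ∈ I
  apply zorn_retr K {Z | ∃ I, Q I ∧ Z = ⋃ i ∈ I, W i}
  · intro c hc
    refine ⟨⋃₀ {I | Q I ∧ (⋃ i ∈ I, W i) ∈ c}, ⟨?_, ?_⟩, ?_⟩
    · exact isLowerSet_sUnion (fun I hI => hI.1.1)
    · rintro i ⟨I, hI, hi⟩ x hx d hd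
      exact ⟨I, hI, hI.1.2 i hi x hx d hd⟩
    · ext x
      constructor
      · rintro ⟨Z, hZ, hx⟩
        obtain ⟨I, hI, rfl⟩ := hc hZ
        obtain ⟨i, hi, hx⟩ := mem_iUnion₂.1 hx
        exact mem_iUnion₂.2 ⟨i, ⟨I, ⟨hI, hZ⟩, hi⟩, hx⟩
      · intro hx
        obtain ⟨i, ⟨I, hI, hi⟩, hx⟩ := mem_iUnion₂.1 hx
        exact ⟨_, hI.2, mem_iUnion₂.2 ⟨i, hi, hx⟩⟩
  · rintro Z ⟨I, hI, rfl⟩ x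
    by_cases hu : I = Set.univ
    · refine ⟨⋃ i ∈ I, W i, ⟨I, hI, rfl⟩, subset_rfl, ?_, good_self _ _⟩
      refine mem_iUnion₂.2 ⟨e.symm x, by rw [hu]; trivial, hex _ ?_⟩
      simp
    · obtain ⟨α, hα⟩ : ∃ α, I = Iio α := by
        have hne : (Iᶜ).Nonempty := nonempty_compl.2 hu
        refine ⟨(wellFounded_lt (α := (#X).ord.ToType)).min Iᶜ hne, ?_⟩
        ext i
        constructor
        · intro hi
          by_contra hcon
          exact (wellFounded_lt (α := (#X).ord.ToType)).min_mem Iᶜ hne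
            (hI.1 (not_lt.1 hcon) hi)
        · intro hi
          by_contra hcon
          exact (wellFounded_lt (α := (#X).ord.ToType)).not_lt_min Iᶜ hcon hi
      subst hα
      obtain ⟨β, hβ1, hβ2⟩ := exists_club hreg h0 W hcard hmono g (max α (e.symm x))
      have hsub : (⋃ i ∈ Iio α, W i) ⊆ ⋃ i ∈ Iio β, W i :=
        biUnion_subset_biUnion_left (fun i hi =>
          lt_trans hi (lt_of_le_of_lt (le_max_left _ _) hβ1))
      have hZ'cl : TClosed τ (⋃ i ∈ Iio β, W i) :=
        tclosed_biUnion τ _ _ (hch _) (fun i _ => hcl i)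
      have hZ'card : #(⋃ i ∈ Iio β, W i : Set X) < #X := by
        rw [biUnion_eq_iUnion]
        exact (card_iUnion_lt_iff_forall_of_isRegular hreg (mk_Iio_toType_ord_lt β)).2
          (fun i => hcard _)
      refine ⟨⋃ i ∈ Iio β, W i, ⟨Iio β, ⟨isLowerSet_Iio β, hβ2⟩, rfl⟩, hsub, ?_, ?_⟩
      · refine mem_iUnion₂.2 ⟨e.symm x, lt_of_le_of_lt (le_max_right _ _) hβ1, hex _ ?_⟩
        simp
      · apply transfer τ hτ hsub hZ'cl
        · have h1 := hrel α hI.2 (⋃ i ∈ Iio β, W i) hZ'cl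
          rw [← biUnion_eq_iUnion (Iio α) (fun i _ => W i)] at h1
          exact h1 hsub hZ'card
        · intro K' hK'
          exact IH _ ((mk_le_mk_of_subset diff_subset).trans_lt hZ'card) K' hK'

theorem exists_excellent {R : Type u} [CommRing R] (h : IsSemisimpleRing (FractionRing R))
    {X : Type u} {K : Submodule R (X →₀ R)} (hK : BaerPair K)
    (τ : K →ₗ[R] (K →₀ R)) (hτ : ∀ k, Finsupp.linearCombination R (id : K → K) (τ k) = k)
    (μ : Cardinal.{u}) (hμ : ℵ₀ ≤ μ)
    (IH : ∀ Y : Type u, #Y ≤ μ → ∀ K' : Submodule R (Y →₀ R), BaerPair K' → HasRetr K')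
    (Z0 : Set X) (hZ0 : #Z0 ≤ μ) :
    ∃ Z : Set X, Z0 ⊆ Z ∧ TClosed τ Z ∧ #Z ≤ μ ∧
      ∀ Z', TClosed τ Z' → Z ⊆ Z' → #Z' ≤ μ → Good K Z Z' := by
  classical
  have hreg : (Order.succ μ).IsRegular := isRegular_succ hμ
  have h0 : ℵ₀ < Order.succ μ := Order.lt_succ_of_le hμ
  obtain ⟨W, g, hcl, hcard, hex, hmono, hrel⟩ := lemma_R h hK τ hτ hreg h0 (fun a => Z0)
    (fun a => Order.lt_succ_of_le hZ0)
  obtain ⟨a, -⟩ := exists_ub hreg ∅ (by simpa using (Order.bot_lt_succ μ))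
  obtain ⟨b, hab, hb⟩ := exists_club hreg h0 W hcard hmono g a
  refine ⟨⋃ i : Iio b, W i, (hex a).trans (subset_iUnion (fun i : Iio b => W i) ⟨a, hab⟩), ?_, ?_, ?_⟩
  · rw [← biUnion_eq_iUnion (Iio b) (fun i _ => W i)]
    refine tclosed_biUnion τ _ _ ?_ (fun i _ => hcl i)
    intro i _ j _
    rcases le_total i j with hij | hij
    · exact Or.inl (hmono hij)
    · exact Or.inr (hmono hij)
  · apply Order.le_of_lt_succ
    exact (card_iUnion_lt_iff_forall_of_isRegular hreg (mk_Iio_toType_ord_lt b)).2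
      (fun i => hcard _)
  · intro Z' h1 h2 h3
    apply transfer τ hτ h2 h1 (hrel b hb Z' h1 h2 (Order.lt_succ_of_le h3))
    intro K' hK'
    exact IH _ ((mk_le_mk_of_subset diff_subset).trans h3) K' hK'

theorem add_diff_aux {M : Type u} [AddCommGroup M] (a b : M) : a + (b - a) = b := by abel

theorem ext_step {R : Type u} [CommRing R] {X : Type u} (K : Submodule R (X →₀ R)) {Z Z' : Set X}
    (hG : Good K Z Z') (t : (X →₀ R) →ₗ[R] K) (ht : ∀ k : K, SuppIn (k : X →₀ R) Z → t k = k) :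
    ∃ t' : (X →₀ R) →ₗ[R] K, (∀ k : K, SuppIn (k : X →₀ R) Z' → t' k = k) ∧
      ∀ x ∈ Z, t' (Finsupp.single x 1) = t (Finsupp.single x 1) := by
  obtain ⟨e, he⟩ := exists_diff K t
  obtain ⟨g, hg1, hg2⟩ := hG e (fun k hk => by
    rw [he, ht k hk]; exact sub_self k)
  refine ⟨t + g, ?_, ?_⟩
  · intro k hk
    have h1 : (t + g) (k : X →₀ R) = t k + g k := rfl
    rw [h1, hg2 k hk, he]
    exact add_diff_aux (t k) k
  · intro x hx
    have h1 : (t + g) (Finsupp.single x 1) = t (Finsupp.single x 1) + g (Finsupp.single x 1) := rfl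
    rw [h1, hg1 x hx]
    exact add_zero _

theorem singular_case {R : Type u} [CommRing R] (h : IsSemisimpleRing (FractionRing R)) {X : Type u}
    {K : Submodule R (X →₀ R)} (hK : BaerPair K) (h0 : ℵ₀ < #X)
    (IH : ∀ Y : Type u, #Y < #X → ∀ K' : Submodule R (Y →₀ R), BaerPair K' → HasRetr K')
    {θ : Type u} [LinearOrder θ] (hθ : #θ < #X) (D : θ → Set X) (hD : Monotone D)
    (hDc : ∀ i, #(D i) < #X) (hDU : ∀ x, ∃ i, x ∈ D i) :
    HasRetr K := by
  classical
  obtain ⟨τ, hτ⟩ := exists_tau h K hK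
  let μ : θ → Cardinal.{u} := fun i => max #(D i) (max #θ ℵ₀)
  have hμ0 : ∀ i, ℵ₀ ≤ μ i := fun i => (le_max_right _ _).trans (le_max_right _ _)
  have hμθ : ∀ i, #θ ≤ μ i := fun i => (le_max_left _ _).trans (le_max_right _ _)
  have hμD : ∀ i, #(D i) ≤ μ i := fun i => le_max_left _ _
  have hμX : ∀ i, μ i < #X := fun i => max_lt (hDc i) (max_lt hθ h0)
  have hμm : ∀ i j, i ≤ j → μ i ≤ μ j := fun i j hij =>
    max_le_max (mk_le_mk_of_subset (hD hij)) le_rfl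
  have IHμ : ∀ i, ∀ Y : Type u, #Y ≤ μ i → ∀ K' : Submodule R (Y →₀ R), BaerPair K' → HasRetr K' :=
    fun i Y hY => IH Y (hY.trans_lt (hμX i))
  have hexc := fun i => exists_excellent h hK τ hτ (μ i) (hμ0 i) (IHμ i)
  let OK : θ → Set X × ((X →₀ R) →ₗ[R] K) → Prop := fun i s =>
    TClosed τ s.1 ∧ #(s.1) ≤ μ i ∧ (∀ Z', TClosed τ Z' → s.1 ⊆ Z' → #Z' ≤ μ i → Good K s.1 Z') ∧
      ∀ k : K, SuppIn (k : X →₀ R) s.1 → s.2 k = k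
  let St : Type u := ∀ i, {s : Set X × ((X →₀ R) →ₗ[R] K) // OK i s}
  have init : Nonempty St := by
    refine ⟨fun i => Classical.choice ?_⟩
    obtain ⟨Z, -, h1, h2, h3⟩ := hexc i ∅ (by simp)
    have hG : Good K ∅ Z := by
      refine transfer τ hτ (empty_subset _) h1 ?_ (fun K' hK' => IHμ i _
        ((mk_le_mk_of_subset diff_subset).trans h2) K' hK')
      intro T _ _ hT e _
      obtain ⟨g, hg⟩ := hK T hT e
      exact ⟨g, fun z hz => absurd hz (notMem_empty z), fun k _ => hg k⟩
    obtain ⟨t, ht, -⟩ := ext_step K hG 0 (by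
      intro k hk
      have : k = 0 := by
        apply Subtype.ext
        ext x
        by_contra hx
        exact hk x hx
      rw [this]
      rfl)
    exact ⟨⟨(Z, t), h1, h2, h3, ht⟩⟩
  have step : ∀ s : St, ∃ s' : St, ∀ i,
      D i ⊆ (s' i).1.1 ∧ (∀ j ≤ i, (s j).1.1 ⊆ (s' i).1.1) ∧
      (∀ j, ∀ x ∈ (s i).1.1, SuppIn (((s j).1.2 (Finsupp.single x 1) : K) : X →₀ R) (s' i).1.1) ∧
      (∀ x ∈ (s i).1.1, (s' i).1.2 (Finsupp.single x 1) = (s i).1.2 (Finsupp.single x 1)) := by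
    intro s
    have hi : ∀ i, ∃ s'i : {s : Set X × ((X →₀ R) →ₗ[R] K) // OK i s},
      D i ⊆ s'i.1.1 ∧ (∀ j ≤ i, (s j).1.1 ⊆ s'i.1.1) ∧
      (∀ j, ∀ x ∈ (s i).1.1, SuppIn (((s j).1.2 (Finsupp.single x 1) : K) : X →₀ R) s'i.1.1) ∧
      (∀ x ∈ (s i).1.1, s'i.1.2 (Finsupp.single x 1) = (s i).1.2 (Finsupp.single x 1)) := by
      intro i
      let U1 : Set X := ⋃ j : Iic i, (s j).1.1
      let U2 : Set X := ⋃ j : θ, ⋃ x : (s i).1.1,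
        ((((s j).1.2 (Finsupp.single x.1 1) : K) : X →₀ R).support : Set X)
      obtain ⟨Z, hZ0, h1, h2, h3⟩ := hexc i (D i ∪ (U1 ∪ U2)) (by
        refine card_union_le' (hμ0 i) _ _ (hμD i) (card_union_le' (hμ0 i) _ _ ?_ ?_)
        · exact card_iUnion_le' (hμ0 i) _ ((mk_set_le _).trans (hμθ i))
            (fun j => (s j).2.2.1.trans (hμm _ _ j.2))
        · exact card_iUnion_le' (hμ0 i) _ (hμθ i) (fun j =>
            card_iUnion_le' (hμ0 i) _ (s i).2.2.1 (fun x => card_finset_coe_le (hμ0 i) _)))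
      have hU1 : ∀ j ≤ i, (s j).1.1 ⊆ Z := fun j hj =>
        (subset_iUnion (fun j : Iic i => (s j).1.1) ⟨j, hj⟩).trans
          ((subset_union_left.trans subset_union_right).trans hZ0)
      have hU2 : U2 ⊆ Z := (subset_union_right.trans subset_union_right).trans hZ0
      obtain ⟨t, ht1, ht2⟩ := ext_step K ((s i).2.2.2.1 Z h1 (hU1 i le_rfl) h2) (s i).1.2
        (s i).2.2.2.2
      refine ⟨⟨(Z, t), h1, h2, h3, ht1⟩, subset_union_left.trans hZ0, hU1, ?_, ht2⟩
      intro j x hx y hy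
      apply hU2
      exact mem_iUnion.2 ⟨j, mem_iUnion.2 ⟨⟨x, hx⟩, Finsupp.mem_support_iff.2 hy⟩⟩
    choose s' hs' using hi
    exact ⟨s', hs'⟩
  obtain ⟨s0⟩ := init
  choose nx hnx1 hnx2 hnx3 hnx4 using step
  let s : ℕ → St := fun n => nx^[n] s0
  have hs : ∀ n, s (n+1) = nx (s n) := fun n => Function.iterate_succ_apply' nx n s0
  let Zn : ℕ → θ → Set X := fun n i => (s n i).1.1
  let tn : ℕ → θ → ((X →₀ R) →ₗ[R] K) := fun n i => (s n i).1.2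
  have e1 : ∀ n i, D i ⊆ Zn (n+1) i := by
    intro n i; simp only [Zn, hs]; exact hnx1 _ i
  have e2 : ∀ n i j, j ≤ i → Zn n j ⊆ Zn (n+1) i := by
    intro n i j hj; simp only [Zn, hs]; exact hnx2 _ i j hj
  have e3 : ∀ n i j, ∀ x ∈ Zn n i,
      SuppIn ((tn n j (Finsupp.single x 1) : K) : X →₀ R) (Zn (n+1) i) := by
    intro n i j x hx; simp only [Zn, hs]; exact hnx3 _ i j x hx
  have e4 : ∀ n i, ∀ x ∈ Zn n i, tn (n+1) i (Finsupp.single x 1) = tn n i (Finsupp.single x 1) := by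
    intro n i x hx; simp only [tn, hs]; exact hnx4 _ i x hx
  have e5 : ∀ n i, ∀ k : K, SuppIn (k : X →₀ R) (Zn n i) → tn n i k = k := fun n i =>
    (s n i).2.2.2.2
  clear_value Zn tn
  have hmn : ∀ i, Monotone fun n => Zn n i := fun i =>
    monotone_nat_of_le_succ (fun n => e2 n i i le_rfl)
  have e6 : ∀ n m i, n ≤ m → ∀ x ∈ Zn n i,
      tn m i (Finsupp.single x 1) = tn n i (Finsupp.single x 1) := by
    intro n m i hnm x hx
    induction m, hnm using Nat.le_induction with
    | base => rfl
    | succ m hm ih => rw [e4 m i x (hmn i hm hx), ih]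
  let Z : θ → Set X := fun i => ⋃ n, Zn n i
  have hZmem : ∀ i x, x ∈ Z i ↔ ∃ n, x ∈ Zn n i := fun i x => mem_iUnion
  have hZm : Monotone Z := by
    intro i j hij x hx
    obtain ⟨n, hn⟩ := (hZmem i x).1 hx
    exact (hZmem j x).2 ⟨n+1, e2 n j i hij hn⟩
  have ht : ∀ i, ∃ t : (X →₀ R) →ₗ[R] K, ∀ n, ∀ x ∈ Zn n i,
      t (Finsupp.single x 1) = tn n i (Finsupp.single x 1) := by
    intro i
    refine ⟨Finsupp.linearCombination R (fun x => if hx : ∃ n, x ∈ Zn n i then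
      tn (Nat.find hx) i (Finsupp.single x 1) else 0), ?_⟩
    intro n x hx
    have hx' : ∃ n, x ∈ Zn n i := ⟨n, hx⟩
    rw [Finsupp.linearCombination_single, one_smul, dif_pos hx']
    exact (e6 _ n i (Nat.find_min' hx' hx) x (Nat.find_spec hx')).symm
  choose t ht using ht
  have htid : ∀ i, ∀ k : K, SuppIn (k : X →₀ R) (Z i) → t i k = k := by
    intro i k hk
    obtain ⟨n, -, hn⟩ := suppIn_of_directed (univ : Set ℕ) (fun n => Zn n i) ⟨0, mem_univ _⟩
      (by
        intro a _ b _
        rcases le_total a b with hab | hab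
        · exact Or.inl (hmn i hab)
        · exact Or.inr (hmn i hab)) (k : X →₀ R) (by
        rw [biUnion_univ]; exact hk)
    rw [← e5 n i k hn]
    rw [e5 n i k hn]
    rw [finsupp_agree (t i) (tn n i) (k : X →₀ R) (fun x hx => ht i n x (hn x hx))]
    exact e5 n i k hn
  have htsupp : ∀ i j, ∀ x ∈ Z i, x ∈ Z j →
      SuppIn ((t j (Finsupp.single x 1) : K) : X →₀ R) (Z i) := by
    intro i j x hxi hxj
    obtain ⟨n, hn⟩ := (hZmem i x).1 hxi
    obtain ⟨m, hm⟩ := (hZmem j x).1 hxj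
    rw [ht j (max n m) x (hmn j (le_max_right _ _) hm)]
    exact (e3 (max n m) i j x (hmn i (le_max_left _ _) hn)).mono
      (subset_iUnion (fun n => Zn n i) _)
  apply zorn_retr K {Y | ∃ I : Set θ, IsLowerSet I ∧ Y = ⋃ i ∈ I, Z i}
  · intro c hc
    refine ⟨⋃₀ {I | IsLowerSet I ∧ (⋃ i ∈ I, Z i) ∈ c}, ?_, ?_⟩
    · exact isLowerSet_sUnion (fun I hI => hI.1)
    · ext x
      constructor
      · rintro ⟨Y, hY, hx⟩
        obtain ⟨I, hI, rfl⟩ := hc hY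
        obtain ⟨i, hi, hx⟩ := mem_iUnion₂.1 hx
        exact mem_iUnion₂.2 ⟨i, ⟨I, ⟨hI, hY⟩, hi⟩, hx⟩
      · intro hx
        obtain ⟨i, ⟨I, hI, hi⟩, hx⟩ := mem_iUnion₂.1 hx
        exact ⟨_, hI.2, mem_iUnion₂.2 ⟨i, hi, hx⟩⟩
  · rintro Y ⟨I, hI, rfl⟩ x
    obtain ⟨j, hj⟩ := hDU x
    have hxj : x ∈ Z j := (hZmem j x).2 ⟨1, e1 0 j hj⟩
    by_cases hjI : j ∈ I
    · exact ⟨_, ⟨I, hI, rfl⟩, subset_rfl, mem_iUnion₂.2 ⟨j, hjI, hxj⟩, good_self _ _⟩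
    · have hIj : ∀ i ∈ I, i ≤ j := fun i hi => by
        by_contra hcon
        exact hjI (hI (not_le.1 hcon).le hi)
      have hZj : (⋃ i ∈ Iic j, Z i) = Z j := by
        apply Subset.antisymm
        · exact iUnion₂_subset (fun i hi => hZm hi)
        · exact subset_biUnion_of_mem (u := Z) (self_mem_Iic)
      refine ⟨Z j, ⟨Iic j, isLowerSet_Iic j, hZj.symm⟩, iUnion₂_subset (fun i hi => hZm (hIj i hi)),
        hxj, ?_⟩
      intro e he
      refine ⟨e ∘ₗ t j, ?_, ?_⟩
      · intro z hz
        obtain ⟨i, hi, hz⟩ := mem_iUnion₂.1 hz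
        apply he
        exact (htsupp i j z hz (hZm (hIj i hi) hz)).mono (subset_biUnion_of_mem (u := Z) hi)
      · intro k hk
        have h1 : (e ∘ₗ t j) (k : X →₀ R) = e (t j k) := rfl
        rw [h1, htid j k hk]

theorem main_retr {R : Type u} [CommRing R] (h : IsSemisimpleRing (FractionRing R)) :
    ∀ (c : Cardinal.{u}) (X : Type u), #X = c →
      ∀ K : Submodule R (X →₀ R), BaerPair K → HasRetr K := by
  intro c
  induction c using WellFoundedLT.induction with
  | ind c ih =>
    rintro X rfl K hK
    have IH : ∀ Y : Type u, #Y < #X → ∀ K' : Submodule R (Y →₀ R), BaerPair K' → HasRetr K' :=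
      fun Y hY => ih _ hY Y rfl
    rcases le_or_gt #X ℵ₀ with hc | h0
    · haveI : Countable X := mk_le_aleph0_iff.1 hc
      exact count_retr h K hK
    · by_cases hcof : #X ≤ (#X).ord.cof
      · exact regular_case h hK ⟨h0.le, hcof⟩ h0 IH
      · obtain ⟨e⟩ : Nonempty ((#X).ord.ToType ≃ X) := by
          rw [← Cardinal.eq, Cardinal.mk_toType, Cardinal.card_ord]
        obtain ⟨S, hS, hSc⟩ := Order.exists_cof_eq (#X).ord.ToType
        rw [Ordinal.cof_toType] at hSc
        refine singular_case h hK h0 IH (θ := S) (by rw [hSc]; exact not_le.1 hcof)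
          (fun i => e '' Iic i.1) ?_ ?_ ?_
        · intro i j hij
          exact image_mono (Iic_subset_Iic.2 hij)
        · intro i
          apply mk_image_le.trans_lt
          rw [← Iio_insert]
          apply (mk_insert_le).trans_lt
          exact add_lt_of_lt h0.le (mk_Iio_toType_ord_lt _) (one_lt_aleph0.trans h0)
        · intro x
          obtain ⟨i, hi, hle⟩ := hS (e.symm x)
          exact ⟨⟨i, hi⟩, e.symm x, hle, by simp⟩

end MainInduction

theorem final_split {R : Type u} [CommRing R] {F B : Type u} [AddCommGroup F] [Module R F]
    [AddCommGroup B] [Module R B] [Module.Projective R F] (q : F →ₗ[R] B)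
    (hq : Function.Surjective q) (hr : HasRetr (LinearMap.ker q)) : Module.Projective R B := by
  obtain ⟨t, ht⟩ := hr
  let e : F →ₗ[R] F := LinearMap.id - (LinearMap.ker q).subtype ∘ₗ t
  have he : ∀ f, e f = f - (t f : F) := fun _ => rfl
  obtain ⟨i, hi⟩ := exists_desc q hq e (by
    intro a b hab
    have hk : a - b ∈ LinearMap.ker q := by
      rw [LinearMap.mem_ker, map_sub, hab, sub_self]
    have h0 : e (a - b) = 0 := by
      rw [he, ht ⟨a - b, hk⟩]
      exact sub_self _
    rw [map_sub] at h0
    exact sub_eq_zero.1 h0)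
  refine Module.Projective.of_split i q ?_
  ext b
  obtain ⟨f, rfl⟩ := hq b
  have h1 : q (t f : F) = 0 := (t f).2
  simp only [LinearMap.comp_apply, LinearMap.id_apply]
  rw [hi, he, map_sub, h1, sub_zero]

/-- If the total ring of quotients of `R` is semisimple, then every Baer `R`-module
is projective. -/
theorem stmt15 (R : Type u) [CommRing R] (h : IsSemisimpleRing (FractionRing R))
    (B : Type u) [AddCommGroup B] [Module R B]
    (hB : ∀ (T : Type u) [AddCommGroup T] [Module R T], Module.IsTorsion R T →
      Subsingleton (extGroup R 1 B T)) :
    Module.Projective R B := by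
  have hq : Function.Surjective (Finsupp.linearCombination R (id : B → B)) := by
    intro b
    exact ⟨Finsupp.single b 1, by simp⟩
  exact final_split _ hq
    (main_retr h _ B rfl _ (baerPair_of_ext R B (B →₀ R) hB _ hq))
end
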